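/- arXiv:1603.08487 — 2 statements merged into one kernel-verified Lean document; each statement's English description precedes it below -/
import Mathlib

section
/- The set 𝖢_n is a K-linear basis of Y_{d,n}^B. -/
noncomputable section

/-- The field `K = ℂ(u,v)` of rational functions in two indeterminates over `ℂ`. -/
abbrev Kf : Type := FractionRing (MvPolynomial (Fin 2) ℂ)

/-- The indeterminate `u`. -/
def uu : Kf := algebraMap (MvPolynomial (Fin 2) ℂ) Kf (MvPolynomial.X 0)

/-- The indeterminate `v`. -/
def vv : Kf := algebraMap (MvPolynomial (Fin 2) ℂ) Kf (MvPolynomial.X 1)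

/-- Generators of the framization of the Hecke algebra of type B on `n` strands:
`b` is the generator `b₁`, `g i` is the braiding generator `g_{i+1}` (`i : Fin (n-1)`),
and `t j` is the framing generator `t_{j+1}` (`j : Fin n`). -/
inductive Gen (n : ℕ) : Type
  | b : Gen n
  | g : Fin (n - 1) → Gen n
  | t : Fin n → Gen n

/-- The free algebra on the generators. -/
abbrev FA (n : ℕ) : Type := FreeAlgebra Kf (Gen n)

/-- The generator `b₁` in the free algebra. -/
def Bb (n : ℕ) : FA n := FreeAlgebra.ι Kf Gen.b

/-- The generator `g_i` (for `1 ≤ i ≤ n-1`) in the free algebra; junk value `1` out of range. -/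
def Gg (n i : ℕ) : FA n :=
  if h : 1 ≤ i ∧ i ≤ n - 1 then FreeAlgebra.ι Kf (Gen.g ⟨i - 1, by omega⟩) else 1

/-- The generator `t_j` (for `1 ≤ j ≤ n`) in the free algebra; junk value `1` out of range. -/
def Tt (n j : ℕ) : FA n :=
  if h : 1 ≤ j ∧ j ≤ n then FreeAlgebra.ι Kf (Gen.t ⟨j - 1, by omega⟩) else 1

/-- The element `e_i = (1/d) ∑_{m=0}^{d-1} t_i^m t_{i+1}^{d-m}` in the free algebra. -/
def eF (d n i : ℕ) : FA n :=
  (d : Kf)⁻¹ • ∑ m ∈ Finset.range d, Tt n i ^ m * Tt n (i + 1) ^ (d - m)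

/-- The element `f₁ = (1/d) ∑_{m=0}^{d-1} t₁^m` in the free algebra. -/
def fF (d n : ℕ) : FA n :=
  (d : Kf)⁻¹ • ∑ m ∈ Finset.range d, Tt n 1 ^ m

/-- The action of the simple transposition `s_i` on indices: swaps `i` and `i+1`. -/
def sAct (i j : ℕ) : ℕ := if j = i then i + 1 else if j = i + 1 then i else j

/-- The defining relations of the framization `Y_{d,n}^B` of the Hecke algebra of type B. -/
inductive YBrel (d n : ℕ) : FA n → FA n → Prop
  | gg : ∀ i j : ℕ, 1 ≤ i → i ≤ n - 1 → 1 ≤ j → j ≤ n - 1 → (i + 1 < j ∨ j + 1 < i) →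
      YBrel d n (Gg n i * Gg n j) (Gg n j * Gg n i)
  | braid : ∀ i : ℕ, 1 ≤ i → i ≤ n - 2 →
      YBrel d n (Gg n i * Gg n (i + 1) * Gg n i) (Gg n (i + 1) * Gg n i * Gg n (i + 1))
  | bg : ∀ i : ℕ, 2 ≤ i → i ≤ n - 1 → YBrel d n (Bb n * Gg n i) (Gg n i * Bb n)
  | bgbg : YBrel d n (Bb n * Gg n 1 * Bb n * Gg n 1) (Gg n 1 * Bb n * Gg n 1 * Bb n)
  | tt : ∀ i j : ℕ, 1 ≤ i → i ≤ n → 1 ≤ j → j ≤ n →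
      YBrel d n (Tt n i * Tt n j) (Tt n j * Tt n i)
  | tg : ∀ i j : ℕ, 1 ≤ i → i ≤ n - 1 → 1 ≤ j → j ≤ n →
      YBrel d n (Tt n j * Gg n i) (Gg n i * Tt n (sAct i j))
  | tb : ∀ i : ℕ, 1 ≤ i → i ≤ n → YBrel d n (Tt n i * Bb n) (Bb n * Tt n i)
  | td : ∀ i : ℕ, 1 ≤ i → i ≤ n → YBrel d n (Tt n i ^ d) 1
  | gsq : ∀ i : ℕ, 1 ≤ i → i ≤ n - 1 →
      YBrel d n (Gg n i ^ 2) (1 + (uu - uu⁻¹) • (eF d n i * Gg n i))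
  | bsq : YBrel d n (Bb n ^ 2) (1 + (vv - vv⁻¹) • (fF d n * Bb n))

/-- The framization of the Hecke algebra of type B, `Y_{d,n}^B`. -/
abbrev YB (d n : ℕ) : Type := RingQuot (YBrel d n)

instance (d n : ℕ) : Ring (YB d n) := RingQuot.instRing (YBrel d n)

instance (d n : ℕ) : Algebra Kf (YB d n) := RingQuot.instAlgebra _

instance (d n : ℕ) : Module Kf (YB d n) := Algebra.toModule

/-- The canonical projection from the free algebra onto `Y_{d,n}^B`. -/
def mkY (d n : ℕ) : FA n →ₐ[Kf] YB d n := RingQuot.mkAlgHom Kf (YBrel d n)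

/-- The generator `b₁` of `Y_{d,n}^B`. -/
def bY (d n : ℕ) : YB d n := mkY d n (Bb n)

/-- The generator `g_i` of `Y_{d,n}^B`. -/
def gY (d n : ℕ) (i : ℕ) : YB d n := mkY d n (Gg n i)

/-- The generator `t_j` of `Y_{d,n}^B`. -/
def tY (d n : ℕ) (j : ℕ) : YB d n := mkY d n (Tt n j)

/-- The idempotent `e_i` of `Y_{d,n}^B`. -/
def eY (d n : ℕ) (i : ℕ) : YB d n := mkY d n (eF d n i)

/-- The idempotent `f₁` of `Y_{d,n}^B`. -/
def fY (d n : ℕ) : YB d n := mkY d n (fF d n)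

/-- The element `g_i⁻¹ = g_i - (u - u⁻¹) e_i`. -/
def gInv (d n i : ℕ) : YB d n := gY d n i - (uu - uu⁻¹) • eY d n i

/-- The elements `b_k := g_{k-1} ⋯ g_1 b_1 g_1⁻¹ ⋯ g_{k-1}⁻¹` for `2 ≤ k ≤ n`,
defined by `b_k = g_{k-1} b_{k-1} g_{k-1}⁻¹`; with `b_1` the generator `b₁`. -/
def bk (d n : ℕ) : ℕ → YB d n
  | 0 => 1
  | 1 => bY d n
  | (k + 2) => gY d n (k + 1) * bk d n (k + 1) * gInv d n (k + 1)

/-- The descending product `g_{k-1} g_{k-2} ⋯ g_j`. -/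
def gRange (d n j k : ℕ) : YB d n := (((List.range' j (k - j)).reverse).map (gY d n)).prod

/-- The elements `𝔪⁺_{k,j,m}`: `𝔪⁺_{k,k,m} = t_k^m` and
`𝔪⁺_{k,j,m} = g_{k-1} ⋯ g_j t_j^m` for `j < k`. -/
def mPlus (d n k j m : ℕ) : YB d n :=
  if j = k then tY d n k ^ m else gRange d n j k * tY d n j ^ m

/-- The elements `𝔪⁻_{k,j,m}`: `𝔪⁻_{k,k,m} = t_k^m b_k` and
`𝔪⁻_{k,j,m} = g_{k-1} ⋯ g_j b_j t_j^m` for `j < k`. -/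
def mMinus (d n k j m : ℕ) : YB d n :=
  if j = k then tY d n k ^ m * bk d n k else gRange d n j k * (bk d n j * tY d n j ^ m)

/-- The subsets `M_{d,k}` of `Y_{d,n}^B`:
`M_{d,1} = {t₁^m, t₁^m b₁}` and `M_{d,k} = {t_k^m, t_k^m b_k, g_{k-1} x : x ∈ M_{d,k-1}}`. -/
def Mset (d n : ℕ) : ℕ → Set (YB d n)
  | 0 => {1}
  | 1 => {x | ∃ m ≤ d - 1, x = tY d n 1 ^ m ∨ x = tY d n 1 ^ m * bY d n}
  | (k + 2) => {x |
      (∃ m ≤ d - 1, x = tY d n (k + 2) ^ m ∨ x = tY d n (k + 2) ^ m * bk d n (k + 2)) ∨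
      ∃ y ∈ Mset d n (k + 1), x = gY d n (k + 1) * y}

/-- The set `𝖢_n` of all products `𝔪_1 𝔪_2 ⋯ 𝔪_n` with `𝔪_i ∈ M_{d,i}`. -/
def Cset (d n : ℕ) : Set (YB d n) :=
  {x | ∃ f : Fin n → YB d n, (∀ i : Fin n, f i ∈ Mset d n (i.val + 1)) ∧
    x = (List.ofFn f).prod}

namespace YB

open Finset

variable {d n : ℕ}

section Relations

lemma mkY_rel {a b : FA n} (h : YBrel d n a b) : mkY d n a = mkY d n b :=
  RingQuot.mkAlgHom_rel Kf h

lemma gg {i j : ℕ} (hi : 1 ≤ i) (hi' : i < n) (hj : 1 ≤ j) (hj' : j < n)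
    (hij : i + 1 < j ∨ j + 1 < i) : Commute (gY d n i) (gY d n j) := by
  simpa [gY, Commute, SemiconjBy] using
    mkY_rel (YBrel.gg (d := d) i j hi (by omega) hj (by omega) hij)

lemma braid {i : ℕ} (hi : 1 ≤ i) (hi' : i + 1 < n) :
    gY d n i * gY d n (i + 1) * gY d n i = gY d n (i + 1) * gY d n i * gY d n (i + 1) := by
  simpa [gY] using mkY_rel (YBrel.braid (d := d) i hi (by omega))

lemma bg {i : ℕ} (hi : 2 ≤ i) (hi' : i < n) : Commute (bY d n) (gY d n i) := by
  simpa [gY, bY, Commute, SemiconjBy] using mkY_rel (YBrel.bg (d := d) i hi (by omega))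

lemma bgbg : bY d n * gY d n 1 * bY d n * gY d n 1 =
    gY d n 1 * bY d n * gY d n 1 * bY d n := by
  simpa [gY, bY] using mkY_rel (YBrel.bgbg (d := d) (n := n))

lemma tt {i j : ℕ} (hi : 1 ≤ i) (hi' : i ≤ n) (hj : 1 ≤ j) (hj' : j ≤ n) :
    Commute (tY d n i) (tY d n j) := by
  simpa [tY, Commute, SemiconjBy] using mkY_rel (YBrel.tt (d := d) i j hi hi' hj hj')

lemma tg {i j : ℕ} (hi : 1 ≤ i) (hi' : i < n) (hj : 1 ≤ j) (hj' : j ≤ n) :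
    tY d n j * gY d n i = gY d n i * tY d n (sAct i j) := by
  simpa [tY, gY] using mkY_rel (YBrel.tg (d := d) i j hi (by omega) hj hj')

lemma tb {i : ℕ} (hi : 1 ≤ i) (hi' : i ≤ n) : Commute (tY d n i) (bY d n) := by
  simpa [tY, bY, Commute, SemiconjBy] using mkY_rel (YBrel.tb (d := d) i hi hi')

lemma td {i : ℕ} (hi : 1 ≤ i) (hi' : i ≤ n) : tY d n i ^ d = 1 := by
  simpa [tY] using mkY_rel (YBrel.td (d := d) i hi hi')

lemma gsq {i : ℕ} (hi : 1 ≤ i) (hi' : i < n) :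
    gY d n i * gY d n i = 1 + (uu - uu⁻¹) • (eY d n i * gY d n i) := by
  simpa only [gY, eY, map_add, map_smul, map_mul, map_one, pow_two] using
    mkY_rel (YBrel.gsq (d := d) i hi (by omega))

lemma bsq : bY d n * bY d n = 1 + (vv - vv⁻¹) • (fY d n * bY d n) := by
  simpa only [bY, fY, map_add, map_smul, map_mul, map_one, pow_two] using
    mkY_rel (YBrel.bsq (d := d) (n := n))

lemma eY_eq (i : ℕ) : eY d n i =
    (d : Kf)⁻¹ • ∑ m ∈ range d, tY d n i ^ m * tY d n (i + 1) ^ (d - m) := by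
  simp only [eY, eF, tY, map_smul, map_sum, map_mul, map_pow]

lemma fY_eq : fY d n = (d : Kf)⁻¹ • ∑ m ∈ range d, tY d n 1 ^ m := by
  simp only [fY, fF, tY, map_smul, map_sum, map_pow]

end Relations

section Consequences

lemma commute_t_g {i j : ℕ} (hi : 1 ≤ i) (hi' : i < n) (hj : 1 ≤ j) (hj' : j ≤ n)
    (h : j ≠ i) (h' : j ≠ i + 1) : Commute (tY d n j) (gY d n i) := by
  have := tg (d := d) hi hi' hj hj'
  rwa [sAct, if_neg h, if_neg h'] at this

lemma t_succ_g {i : ℕ} (hi : 1 ≤ i) (hi' : i < n) :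
    SemiconjBy (gY d n i) (tY d n i) (tY d n (i + 1)) := by
  have := tg (d := d) (j := i + 1) hi hi' (by omega) (by omega)
  simp only [sAct, Nat.succ_ne_self, if_false, if_true] at this
  exact this.symm

lemma t_g {i : ℕ} (hi : 1 ≤ i) (hi' : i < n) :
    SemiconjBy (gY d n i) (tY d n (i + 1)) (tY d n i) := by
  have := tg (d := d) (j := i) hi hi' hi (by omega)
  simp only [sAct, if_true] at this
  exact this.symm

lemma commute_e_of_commute {i : ℕ} {a : YB d n} (h : Commute a (tY d n i))
    (h' : Commute a (tY d n (i + 1))) : Commute a (eY d n i) := by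
  rw [eY_eq]
  exact (Commute.sum_right _ _ _ fun m _ => (h.pow_right m).mul_right (h'.pow_right _)).smul_right _

lemma sum_pow_mul_pow_symm {R : Type*} [Ring R] {a b : R} (hab : Commute a b)
    (ha : a ^ d = 1) (hb : b ^ d = 1) :
    ∑ m ∈ range d, b ^ m * a ^ (d - m) = ∑ m ∈ range d, a ^ m * b ^ (d - m) := by
  have h : ∑ m ∈ range (d + 1), b ^ m * a ^ (d - m) =
      ∑ m ∈ range (d + 1), a ^ m * b ^ (d - m) := by
    rw [← sum_range_reflect]
    refine sum_congr rfl fun m hm => ?_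
    have hm : m ≤ d := Nat.lt_succ_iff.mp (mem_range.mp hm)
    rw [show d + 1 - 1 - m = d - m by omega, show d - (d - m) = m by omega,
      (hab.pow_pow m (d - m)).eq]
  simpa [sum_range_succ, ha, hb] using h

lemma commute_g_e {i : ℕ} (hi : 1 ≤ i) (hi' : i < n) : Commute (gY d n i) (eY d n i) := by
  rw [eY_eq]
  refine Commute.smul_right ?_ _
  have key : gY d n i * ∑ m ∈ range d, tY d n i ^ m * tY d n (i + 1) ^ (d - m) =
      (∑ m ∈ range d, tY d n (i + 1) ^ m * tY d n i ^ (d - m)) * gY d n i := by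
    rw [mul_sum, sum_mul]
    exact sum_congr rfl fun m _ =>
      (((t_succ_g hi hi').pow_right m).mul_right ((t_g hi hi').pow_right (d - m))).eq
  rw [Commute, SemiconjBy, key, sum_pow_mul_pow_symm (tt hi (by omega) (by omega) (by omega))
    (td hi (by omega)) (td (by omega) (by omega))]

lemma g_mul_gInv {i : ℕ} (hi : 1 ≤ i) (hi' : i < n) : gY d n i * gInv d n i = 1 := by
  rw [gInv, mul_sub, gsq hi hi', mul_smul_comm, (commute_g_e hi hi').eq, add_sub_cancel_right]

lemma gInv_mul_g {i : ℕ} (hi : 1 ≤ i) (hi' : i < n) : gInv d n i * gY d n i = 1 := by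
  rw [gInv, sub_mul, gsq hi hi', smul_mul_assoc, add_sub_cancel_right]

/-- The generator `g_i` as a unit. -/
def gUnit {i : ℕ} (hi : 1 ≤ i) (hi' : i < n) : (YB d n)ˣ where
  val := gY d n i
  inv := gInv d n i
  val_inv := g_mul_gInv hi hi'
  inv_val := gInv_mul_g hi hi'

lemma gInv_semiconj {i : ℕ} (hi : 1 ≤ i) (hi' : i < n) {x y : YB d n}
    (h : SemiconjBy (gY d n i) x y) : SemiconjBy (gInv d n i) y x :=
  SemiconjBy.units_inv_symm_left (a := gUnit hi hi') h

lemma bk_semiconj {k : ℕ} (hk : k + 1 < n) :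
    SemiconjBy (gY d n (k + 1)) (bk d n (k + 1)) (bk d n (k + 2)) := by
  rw [SemiconjBy, bk, mul_assoc _ (gInv d n (k + 1)), gInv_mul_g (by omega) hk, mul_one]

lemma commute_t_bk {k : ℕ} (hk : k < n) {i : ℕ} (hi : 1 ≤ i) (hi' : i ≤ n) :
    Commute (tY d n i) (bk d n (k + 1)) := by
  induction k generalizing i with
  | zero => exact tb hi hi'
  | succ k ih =>
    have conj : ∀ j, 1 ≤ j → j ≤ n → SemiconjBy (gY d n (k + 1)) (tY d n j) (tY d n i) →
        Commute (tY d n i) (bk d n (k + 2)) := by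
      intro j hj hj' h
      have h2 := gInv_semiconj (by omega) hk h
      exact ((h.mul_left (ih (by omega) hj hj').symm).mul_left h2).symm
    by_cases h1 : i = k + 1
    · exact conj (k + 2) (by omega) (by omega) (by subst h1; exact t_g (by omega) hk)
    by_cases h2 : i = k + 2
    · exact conj (k + 1) (by omega) (by omega) (by subst h2; exact t_succ_g (by omega) hk)
    · exact conj i hi hi' (commute_t_g (by omega) hk hi hi' h1 h2).symm

lemma commute_bk_g {k i : ℕ} (hi : k < i) (hi' : i + 1 < n) :
    Commute (gY d n (i + 1)) (bk d n (k + 1)) := by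
  induction k with
  | zero => exact (bg (by omega) hi').symm
  | succ k ih =>
    have h := gg (d := d) (i := k + 1) (j := i + 1) (n := n) (by omega) (by omega) (by omega) hi'
      (by omega)
    exact (h.symm.mul_right (ih (by omega))).mul_right (gInv_semiconj (by omega) (by omega) h).symm

/-- `b_{k+3}` commutes with `g_{k+1}`. -/
lemma commute_g_bk {k : ℕ} (hk : k + 2 < n) :
    Commute (gY d n (k + 1)) (bk d n (k + 3)) := by
  have hbr := braid (d := d) (n := n) (i := k + 1) (by omega) hk
  have h1 : SemiconjBy (gY d n (k + 2) * gY d n (k + 1)) (gY d n (k + 2)) (gY d n (k + 1)) := by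
    rw [SemiconjBy, ← mul_assoc, hbr]
  have h2 : SemiconjBy (gInv d n (k + 1) * gInv d n (k + 2)) (gY d n (k + 1))
      (gY d n (k + 2)) := by
    exact SemiconjBy.units_inv_symm_left
      (a := gUnit (d := d) (n := n) (i := k + 2) (by omega) hk *
        gUnit (i := k + 1) (by omega) (by omega)) h1
  have h3 := (h1.mul_left (commute_bk_g (d := d) (k := k) (i := k + 1) (by omega) hk).symm).mul_left
    h2
  have : bk d n (k + 3) = gY d n (k + 2) * gY d n (k + 1) * bk d n (k + 1) *
      (gInv d n (k + 1) * gInv d n (k + 2)) := by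
    simp only [bk, mul_assoc]
  rw [this]
  exact SemiconjBy.eq h3 |>.symm

end Consequences

section Spanning

variable (d n) in
/-- The generators of `Y_{d,n}^B` that involve only the first `k` strands. -/
def gens (k : ℕ) : Set (YB d n) :=
  {x | (∃ i, 1 ≤ i ∧ i ≤ k ∧ x = tY d n i) ∨ (∃ i, 1 ≤ i ∧ i < k ∧ x = gY d n i) ∨
    (1 ≤ k ∧ x = bY d n)}

variable (d n) in
/-- The subalgebra generated by the first `k` strands. -/
def strandAlg (k : ℕ) : Subalgebra Kf (YB d n) := Algebra.adjoin Kf (gens d n k)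

variable (d n) in
/-- The left module over the algebra of the first `k` strands generated by `M_{d,k+1}`. -/
def strandMod (k : ℕ) : Submodule Kf (YB d n) :=
  Subalgebra.toSubmodule (strandAlg d n k) * Submodule.span Kf (Mset d n (k + 1))

lemma gens_mono {k l : ℕ} (h : k ≤ l) : gens d n k ⊆ gens d n l := by
  rintro x (⟨i, h1, h2, rfl⟩ | ⟨i, h1, h2, rfl⟩ | ⟨h1, rfl⟩)
  · exact Or.inl ⟨i, h1, by omega, rfl⟩
  · exact Or.inr (Or.inl ⟨i, h1, by omega, rfl⟩)
  · exact Or.inr (Or.inr ⟨by omega, rfl⟩)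

lemma strandAlg_mono {k l : ℕ} (h : k ≤ l) : strandAlg d n k ≤ strandAlg d n l :=
  Algebra.adjoin_mono (gens_mono h)

lemma t_mem_strandAlg {i k : ℕ} (hi : 1 ≤ i) (hk : i ≤ k) : tY d n i ∈ strandAlg d n k :=
  Algebra.subset_adjoin (Or.inl ⟨i, hi, hk, rfl⟩)

lemma g_mem_strandAlg {i k : ℕ} (hi : 1 ≤ i) (hk : i < k) : gY d n i ∈ strandAlg d n k :=
  Algebra.subset_adjoin (Or.inr (Or.inl ⟨i, hi, hk, rfl⟩))

lemma b_mem_strandAlg {k : ℕ} (hk : 1 ≤ k) : bY d n ∈ strandAlg d n k :=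
  Algebra.subset_adjoin (Or.inr (Or.inr ⟨hk, rfl⟩))

lemma t_pow_mod {i : ℕ} (hi : 1 ≤ i) (hi' : i ≤ n) (m : ℕ) :
    tY d n i ^ m = tY d n i ^ (m % d) := by
  conv_lhs => rw [← Nat.div_add_mod m d, pow_add, pow_mul, td hi hi', one_pow, one_mul]

lemma t_pow_mem_Mset (hd : 1 ≤ d) {k : ℕ} (hk : k < n) (m : ℕ) :
    tY d n (k + 1) ^ m ∈ Mset d n (k + 1) := by
  have hm : m % d ≤ d - 1 := Nat.le_sub_one_of_lt (Nat.mod_lt m hd)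
  rw [t_pow_mod (by omega) hk]
  cases k with
  | zero => exact ⟨m % d, hm, Or.inl rfl⟩
  | succ k => exact Or.inl ⟨m % d, hm, Or.inl rfl⟩

lemma t_pow_bk_mem_Mset (hd : 1 ≤ d) {k : ℕ} (hk : k < n) (m : ℕ) :
    tY d n (k + 1) ^ m * bk d n (k + 1) ∈ Mset d n (k + 1) := by
  have hm : m % d ≤ d - 1 := Nat.le_sub_one_of_lt (Nat.mod_lt m hd)
  rw [t_pow_mod (by omega) hk]
  cases k with
  | zero => exact ⟨m % d, hm, Or.inr rfl⟩
  | succ k => exact Or.inl ⟨m % d, hm, Or.inr rfl⟩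

lemma Mset_cases {k : ℕ} {p : YB d n → Prop} (ht : ∀ m, p (tY d n (k + 1) ^ m))
    (hb : ∀ m, p (tY d n (k + 1) ^ m * bk d n (k + 1)))
    (hg : ∀ l, k = l + 1 → ∀ y ∈ Mset d n k, p (gY d n k * y)) :
    ∀ y ∈ Mset d n (k + 1), p y := by
  cases k with
  | zero =>
    rintro y ⟨m, -, rfl | rfl⟩
    exacts [ht m, hb m]
  | succ k =>
    rintro y (⟨m, -, rfl | rfl⟩ | ⟨z, hz, rfl⟩)
    exacts [ht m, hb m, hg k rfl z hz]

lemma Mset_subset_strandMod (k : ℕ) {y : YB d n} (hy : y ∈ Mset d n (k + 1)) :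
    y ∈ strandMod d n k := by
  rw [strandMod]
  simpa only [one_mul] using Submodule.mul_mem_mul (M := Subalgebra.toSubmodule (strandAlg d n k))
    (one_mem (strandAlg d n k)) (Submodule.subset_span hy)

lemma mul_mem_strandMod {k : ℕ} {p u : YB d n} (hp : p ∈ strandAlg d n k)
    (hu : u ∈ strandMod d n k) : p * u ∈ strandMod d n k := by
  refine Submodule.mul_induction_on hu (fun a ha b hb => ?_) fun x y hx hy => ?_
  · rw [← mul_assoc]
    exact Submodule.mul_mem_mul (mul_mem (S := Subalgebra Kf (YB d n)) hp ha) hb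
  · rw [mul_add]
    exact add_mem hx hy

lemma map_mem_of_strandMod {k : ℕ} (f : YB d n →ₗ[Kf] YB d n) (N : Submodule Kf (YB d n))
    (h : ∀ p ∈ strandAlg d n k, ∀ y ∈ Mset d n (k + 1), f (p * y) ∈ N) {u : YB d n}
    (hu : u ∈ strandMod d n k) : f u ∈ N := by
  suffices strandMod d n k ≤ N.comap f from this hu
  refine Submodule.mul_le.2 fun p hp y hy => ?_
  induction hy using Submodule.span_induction with
  | mem y hy => exact h p hp y hy
  | zero => simp
  | add x y _ _ hx hy => rw [mul_add]; exact add_mem hx hy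
  | smul c x _ hx => rw [mul_smul_comm]; exact Submodule.smul_mem _ c hx

lemma strandMod_mul_mem {k : ℕ}
    (h : ∀ y ∈ Mset d n (k + 1), ∀ x ∈ gens d n (k + 1), y * x ∈ strandMod d n k)
    {u x : YB d n} (hu : u ∈ strandMod d n k) (hx : x ∈ strandAlg d n (k + 1)) :
    u * x ∈ strandMod d n k := by
  induction hx using Algebra.adjoin_induction generalizing u with
  | mem x hx =>
    refine map_mem_of_strandMod (LinearMap.mulRight Kf x) _ (fun p hp y hy => ?_) hu
    rw [LinearMap.mulRight_apply, mul_assoc]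
    exact mul_mem_strandMod hp (h y hy x hx)
  | algebraMap r =>
    rw [← Algebra.commutes, ← Algebra.smul_def]
    exact Submodule.smul_mem _ _ hu
  | add x y _ _ hx hy => rw [mul_add]; exact add_mem (hx hu) (hy hu)
  | mul x y _ _ hx hy => rw [← mul_assoc]; exact hy (hx hu)

lemma commute_g_strandAlg {k : ℕ} (hk : k + 1 < n) {p : YB d n} (hp : p ∈ strandAlg d n k) :
    Commute (gY d n (k + 1)) p := by
  refine Algebra.commute_of_mem_adjoin_of_forall_mem_commute hp ?_
  rintro x (⟨i, h1, h2, rfl⟩ | ⟨i, h1, h2, rfl⟩ | ⟨h1, rfl⟩)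
  · exact (commute_t_g (by omega) hk h1 (by omega) (by omega) (by omega)).symm
  · exact gg (by omega) hk h1 (by omega) (by omega)
  · exact (bg (by omega) hk).symm

lemma commute_t_Mset {k j : ℕ} (hk : k < n) (hj : k + 1 < j) (hj' : j ≤ n) :
    ∀ y ∈ Mset d n (k + 1), Commute (tY d n j) y := by
  induction k with
  | zero =>
    have h := tt (d := d) (n := n) (i := j) (j := 1) (by omega) hj' le_rfl (by omega)
    exact Mset_cases (fun m => h.pow_right m)
      (fun m => (h.pow_right m).mul_right (tb (by omega) hj')) (by omega)
  | succ k ih =>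
    have h := tt (d := d) (n := n) (i := j) (j := k + 2) (by omega) hj' (by omega) (by omega)
    exact Mset_cases (fun m => h.pow_right m)
      (fun m => (h.pow_right m).mul_right (commute_t_bk hk (by omega) hj'))
      (fun l hl y hy => (commute_t_g (by omega) hk (by omega) hj' (by omega) (by omega)).mul_right
        (ih (by omega) (by omega) y hy))

lemma commute_g_Mset {k j : ℕ} (hj : k + 1 < j) (hj' : j < n) :
    ∀ y ∈ Mset d n (k + 1), Commute (gY d n j) y := by
  obtain ⟨j, rfl⟩ : ∃ i, j = i + 1 := ⟨j - 1, by omega⟩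
  induction k with
  | zero =>
    have h := (commute_t_g (d := d) (n := n) (i := j + 1) (j := 1) (by omega) hj' le_rfl (by omega)
      (by omega) (by omega)).symm
    exact Mset_cases (fun m => h.pow_right m)
      (fun m => (h.pow_right m).mul_right (bg (by omega) hj').symm) (by omega)
  | succ k ih =>
    have h := (commute_t_g (d := d) (n := n) (i := j + 1) (j := k + 2) (by omega) hj' (by omega)
      (by omega) (by omega) (by omega)).symm
    exact Mset_cases (fun m => h.pow_right m)
      (fun m => (h.pow_right m).mul_right (commute_bk_g (by omega) hj'))
      (fun l hl y hy => (gg (by omega) hj' (by omega) (by omega) (by omega)).mul_right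
        (ih (by omega) y hy))

lemma g_mul_mul_mem {k : ℕ} (hk : k + 1 < n) {x : YB d n}
    (h : ∀ y ∈ Mset d n (k + 1), gY d n (k + 1) * y * x ∈ strandMod d n (k + 1))
    {u : YB d n} (hu : u ∈ strandMod d n k) :
    gY d n (k + 1) * u * x ∈ strandMod d n (k + 1) := by
  refine map_mem_of_strandMod (LinearMap.mulRight Kf x ∘ₗ LinearMap.mulLeft Kf (gY d n (k + 1)))
    _ (fun p hp y hy => ?_) hu
  have : gY d n (k + 1) * (p * y) * x = p * (gY d n (k + 1) * y * x) := by
    rw [← mul_assoc, (commute_g_strandAlg hk hp).eq]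
    simp only [mul_assoc]
  simp only [LinearMap.comp_apply, LinearMap.mulLeft_apply, LinearMap.mulRight_apply, this]
  exact mul_mem_strandMod (strandAlg_mono (by omega) hp) (h y hy)

lemma g_mul_mem {k : ℕ} (hk : k + 1 < n) {u : YB d n} (hu : u ∈ strandMod d n k) :
    gY d n (k + 1) * u ∈ strandMod d n (k + 1) := by
  simpa using g_mul_mul_mem (x := 1) hk
    (fun y hy => Mset_subset_strandMod _ (by rw [mul_one]; exact Or.inr ⟨y, hy, rfl⟩)) hu

lemma t_pow_mem_strandMod (hd : 1 ≤ d) {k : ℕ} (hk : k < n) (m : ℕ) :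
    tY d n (k + 1) ^ m ∈ strandMod d n k :=
  Mset_subset_strandMod _ (t_pow_mem_Mset hd hk m)

lemma t_pow_bk_mem_strandMod (hd : 1 ≤ d) {k : ℕ} (hk : k < n) (m : ℕ) :
    tY d n (k + 1) ^ m * bk d n (k + 1) ∈ strandMod d n k :=
  Mset_subset_strandMod _ (t_pow_bk_mem_Mset hd hk m)

lemma Mset_one_mul_mem (hd : 1 ≤ d) (hn : 0 < n) :
    ∀ y ∈ Mset d n 1, ∀ x ∈ gens d n 1, y * x ∈ strandMod d n 0 := by
  have ht (m : ℕ) : tY d n 1 ^ m ∈ strandMod d n 0 := t_pow_mem_strandMod hd hn m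
  have hb (m : ℕ) : tY d n 1 ^ m * bY d n ∈ strandMod d n 0 := t_pow_bk_mem_strandMod hd hn m
  have htb := tb (d := d) (n := n) (i := 1) le_rfl hn
  refine Mset_cases (fun m x hx => ?_) (fun m x hx => ?_) (by omega)
  all_goals obtain ⟨i, h1, h2, rfl⟩ | ⟨i, h1, h2, rfl⟩ | ⟨-, rfl⟩ := hx
  · obtain rfl : i = 1 := by omega
    rw [zero_add, ← pow_succ]
    exact ht (m + 1)
  · omega
  · exact hb m
  · obtain rfl : i = 1 := by omega
    simp only [bk, zero_add]
    rw [mul_assoc, ← htb.eq, ← mul_assoc, ← pow_succ]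
    exact hb (m + 1)
  · omega
  · simp only [bk, zero_add]
    rw [mul_assoc, bsq, mul_add, mul_one, mul_smul_comm, fY_eq, smul_mul_assoc, mul_smul_comm,
      sum_mul, mul_sum]
    refine add_mem (ht m) (Submodule.smul_mem _ _ (Submodule.smul_mem _ _ (sum_mem fun a _ => ?_)))
    rw [← mul_assoc, ← pow_add]
    exact hb _

section Step

variable {k : ℕ}

/-- `M_{d,k+1}` is stable under right multiplication by the first `k+1` strands, modulo
the action of the first `k` strands. -/
def RightStable (d n k : ℕ) : Prop :=
  ∀ y ∈ Mset d n (k + 1), ∀ x ∈ gens d n (k + 1), y * x ∈ strandMod d n k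

lemma g_mul_mul_t_mem (hk : k + 1 < n) (y : YB d n)
    (hy : y ∈ Mset d n (k + 1)) : gY d n (k + 1) * y * tY d n (k + 2) ∈ strandMod d n (k + 1) := by
  rw [mul_assoc, ← (commute_t_Mset (by omega) (by omega) (by omega) y hy).eq, ← mul_assoc,
    (t_g (by omega) hk).eq, mul_assoc]
  exact mul_mem_strandMod (t_mem_strandAlg (by omega) le_rfl)
    (Mset_subset_strandMod _ (Or.inr ⟨y, hy, rfl⟩))

lemma g_mul_mul_e_mem (hk : k + 1 < n) (ih : RightStable d n k) {u : YB d n}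
    (hu : u ∈ strandMod d n k) :
    gY d n (k + 1) * u * eY d n (k + 1) ∈ strandMod d n (k + 1) := by
  refine g_mul_mul_mem hk (fun y hy => ?_) hu
  rw [eY_eq, mul_smul_comm, mul_sum]
  refine Submodule.smul_mem _ _ (sum_mem fun m _ => ?_)
  rw [((tt (by omega) (by omega) (by omega) (by omega)).pow_pow m (d - m)).eq, ← mul_assoc,
    mul_assoc _ y,
    ← ((commute_t_Mset (by omega) (by omega) (by omega) y hy).pow_left (d - m)).eq, ← mul_assoc,
    ((t_g (by omega) hk).pow_right (d - m)).eq, mul_assoc, mul_assoc]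
  exact mul_mem_strandMod (pow_mem (t_mem_strandAlg (by omega) le_rfl) _)
    (g_mul_mem hk (strandMod_mul_mem ih (Mset_subset_strandMod _ hy)
      (pow_mem (t_mem_strandAlg (by omega) le_rfl) _)))

lemma g_mul_mul_g_of_semiconj (hk : k + 1 < n) (ih : RightStable d n k) {y z : YB d n}
    (hy : y ∈ Mset d n (k + 1)) (hz : z ∈ strandMod d n (k + 1))
    (h : SemiconjBy (gY d n (k + 1)) y z) :
    gY d n (k + 1) * y * gY d n (k + 1) ∈ strandMod d n (k + 1) := by
  have := g_mul_mul_e_mem hk ih (Mset_subset_strandMod _ hy)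
  rw [h.eq, mul_assoc, (commute_g_e (by omega) hk).eq] at this
  rw [h.eq, mul_assoc, gsq (by omega) hk, mul_add, mul_one, mul_smul_comm]
  exact add_mem hz (Submodule.smul_mem _ _ this)

lemma g_mul_mul_g_mem (hd : 1 ≤ d) (hk : k + 1 < n) (ih : RightStable d n k) :
    ∀ y ∈ Mset d n (k + 1),
      gY d n (k + 1) * y * gY d n (k + 1) ∈ strandMod d n (k + 1) := by
  have ht (m : ℕ) := (t_succ_g (d := d) (i := k + 1) (by omega) hk).pow_right m
  refine Mset_cases (fun m => ?_) (fun m => ?_) ?_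
  · exact g_mul_mul_g_of_semiconj hk ih (t_pow_mem_Mset hd (by omega) m)
      (t_pow_mem_strandMod hd hk m) (ht m)
  · exact g_mul_mul_g_of_semiconj hk ih (t_pow_bk_mem_Mset hd (by omega) m)
      (t_pow_bk_mem_strandMod hd hk m) ((ht m).mul_right (bk_semiconj hk))
  · rintro l rfl z hz
    have : gY d n (l + 2) * (gY d n (l + 1) * z) * gY d n (l + 2) =
        gY d n (l + 1) * (gY d n (l + 2) * (gY d n (l + 1) * z)) := by
      rw [mul_assoc, mul_assoc, ← (commute_g_Mset (by omega) hk z hz).eq]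
      simp only [← mul_assoc]
      rw [braid (by omega) hk]
    rw [this]
    exact mul_mem_strandMod (g_mem_strandAlg (by omega) (by omega))
      (Mset_subset_strandMod _ (Or.inr ⟨_, Or.inr ⟨z, hz, rfl⟩, rfl⟩))

lemma g_mul_mul_gInv_mem (hd : 1 ≤ d) (hk : k + 1 < n) (ih : RightStable d n k) {u : YB d n}
    (hu : u ∈ strandMod d n k) :
    gY d n (k + 1) * u * gInv d n (k + 1) ∈ strandMod d n (k + 1) := by
  rw [gInv, mul_sub, mul_smul_comm]
  exact sub_mem (g_mul_mul_mem hk (g_mul_mul_g_mem hd hk ih) hu)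
    (Submodule.smul_mem _ _ (g_mul_mul_e_mem hk ih hu))

lemma t_pow_bk_succ (hk : k + 1 < n) (m : ℕ) : tY d n (k + 2) ^ m * bk d n (k + 2) =
    gY d n (k + 1) * (tY d n (k + 1) ^ m * bk d n (k + 1)) * gInv d n (k + 1) := by
  rw [bk, ← mul_assoc, ← mul_assoc, ← mul_assoc, ((t_succ_g (by omega) hk).pow_right m).eq]

lemma t_pow_bk_mul_mem (hd : 1 ≤ d) (hk : k + 1 < n) (ih : RightStable d n k) (m : ℕ)
    {x : YB d n} (hx : x ∈ gens d n k) :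
    tY d n (k + 2) ^ m * bk d n (k + 2) * x ∈ strandMod d n (k + 1) := by
  have hc := commute_g_strandAlg hk (Algebra.subset_adjoin hx)
  rw [t_pow_bk_succ hk, mul_assoc, (gInv_semiconj (by omega) hk hc).eq, ← mul_assoc,
    mul_assoc _ _ x]
  exact g_mul_mul_gInv_mem hd hk ih (ih _ (t_pow_bk_mem_Mset hd (by omega) m) x
    (gens_mono (by omega) hx))

lemma t_pow_bk_two_mul_b_mem (hd : 1 ≤ d) (hn : 1 < n) (ih : RightStable d n 0) (m : ℕ) :
    tY d n 2 ^ m * bk d n 2 * bY d n ∈ strandMod d n 1 := by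
  have hb : bY d n ∈ gens d n 1 := Or.inr (Or.inr ⟨le_rfl, rfl⟩)
  have hy : tY d n 1 ^ m * bY d n ∈ Mset d n 1 := t_pow_bk_mem_Mset hd (by omega) m
  have hbe : Commute (bY d n) (eY d n 1) := commute_e_of_commute
    (tb le_rfl (by omega)).symm (tb (by omega) (by omega)).symm
  have hbt (j : ℕ) (hj : 1 ≤ j) (hj' : j ≤ n) := ((tb (d := d) hj hj').pow_left m)
  have hg := ((t_succ_g (d := d) (i := 1) le_rfl hn).pow_right m).eq
  have key : gY d n 1 * (tY d n 1 ^ m * bY d n) * gY d n 1 * bY d n =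
      bY d n * (gY d n 1 * (tY d n 1 ^ m * bY d n) * gY d n 1) := by
    calc _ = gY d n 1 * tY d n 1 ^ m * (bY d n * gY d n 1 * bY d n) := by simp only [mul_assoc]
      _ = tY d n 2 ^ m * (gY d n 1 * bY d n * gY d n 1 * bY d n) := by
        rw [hg]; simp only [mul_assoc]
      _ = tY d n 2 ^ m * bY d n * (gY d n 1 * bY d n * gY d n 1) := by
        rw [← bgbg]; simp only [mul_assoc]
      _ = bY d n * (tY d n 2 ^ m * gY d n 1) * (bY d n * gY d n 1) := by
        rw [(hbt 2 (by omega) (by omega)).eq]; simp only [mul_assoc]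
      _ = _ := by rw [← hg]; simp only [mul_assoc]
  rw [t_pow_bk_succ hn]
  simp only [zero_add, bk]
  rw [gInv, mul_sub, sub_mul, mul_smul_comm, smul_mul_assoc, key, mul_assoc _ (eY d n 1),
    ← hbe.eq, ← mul_assoc _ (bY d n) (eY d n 1), mul_assoc (gY d n 1) _ (bY d n)]
  exact sub_mem (mul_mem_strandMod (b_mem_strandAlg le_rfl) (g_mul_mul_g_mem hd hn ih _ hy))
    (Submodule.smul_mem _ _ (g_mul_mul_e_mem hn ih (ih _ hy _ hb)))

lemma t_pow_mul_mem (hd : 1 ≤ d) (hk : k + 1 < n) (m : ℕ) {x : YB d n}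
    (hx : x ∈ gens d n (k + 2)) : tY d n (k + 2) ^ m * x ∈ strandMod d n (k + 1) := by
  have htm := t_pow_mem_strandMod hd hk m
  obtain ⟨i, h1, h2, rfl⟩ | ⟨i, h1, h2, rfl⟩ | ⟨-, rfl⟩ := hx
  · obtain rfl | h := eq_or_ne i (k + 2)
    · rw [← pow_succ]
      exact t_pow_mem_strandMod hd hk (m + 1)
    · rw [((tt (by omega) (by omega) h1 (by omega)).pow_left m).eq]
      exact mul_mem_strandMod (t_mem_strandAlg h1 (by omega)) htm
  · obtain rfl | h := eq_or_ne i (k + 1)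
    · rw [← ((t_succ_g h1 hk).pow_right m).eq]
      exact g_mul_mem hk (t_pow_mem_strandMod hd (by omega) m)
    · rw [((commute_t_g h1 (by omega) (by omega) (by omega) (by omega) (by omega)).pow_left m).eq]
      exact mul_mem_strandMod (g_mem_strandAlg h1 (by omega)) htm
  · rw [((tb (by omega) (by omega)).pow_left m).eq]
    exact mul_mem_strandMod (b_mem_strandAlg (by omega)) htm

lemma t_pow_bk_mul_mem_of_gens (hd : 1 ≤ d) (hk : k + 1 < n) (ih : RightStable d n k) (m : ℕ)
    {x : YB d n} (hx : x ∈ gens d n (k + 2)) :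
    tY d n (k + 2) ^ m * bk d n (k + 2) * x ∈ strandMod d n (k + 1) := by
  have htm := t_pow_bk_mem_strandMod hd hk m
  obtain ⟨i, h1, h2, rfl⟩ | ⟨i, h1, h2, rfl⟩ | ⟨-, rfl⟩ := hx
  · obtain rfl | h := eq_or_ne i (k + 2)
    · rw [mul_assoc, ← (commute_t_bk hk (by omega) (by omega)).eq, ← mul_assoc, ← pow_succ]
      exact t_pow_bk_mem_strandMod hd hk (m + 1)
    · rw [mul_assoc, ← (commute_t_bk hk (by omega) (by omega)).eq, ← mul_assoc,
        ((tt (by omega) (by omega) h1 (by omega)).pow_left m).eq, mul_assoc]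
      exact mul_mem_strandMod (t_mem_strandAlg h1 (by omega)) htm
  · obtain rfl | h := eq_or_ne i (k + 1)
    · rw [t_pow_bk_succ hk, mul_assoc, gInv_mul_g h1 hk, mul_one]
      exact g_mul_mem hk (t_pow_bk_mem_strandMod hd (by omega) m)
    obtain rfl | h' := eq_or_ne i k
    · obtain ⟨l, rfl⟩ : ∃ l, i = l + 1 := ⟨i - 1, by omega⟩
      rw [mul_assoc, ← (commute_g_bk hk).eq, ← mul_assoc, ((commute_t_g h1 (by omega) (by omega)
        (by omega) (by omega) (by omega)).pow_left m).eq, mul_assoc]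
      exact mul_mem_strandMod (g_mem_strandAlg h1 (by omega)) htm
    · exact t_pow_bk_mul_mem hd hk ih m (Or.inr (Or.inl ⟨i, h1, by omega, rfl⟩))
  · cases k with
    | zero => exact t_pow_bk_two_mul_b_mem hd hk ih m
    | succ k => exact t_pow_bk_mul_mem hd hk ih m (Or.inr (Or.inr ⟨by omega, rfl⟩))

end Step

theorem rightStable (hd : 1 ≤ d) {k : ℕ} (hk : k < n) : RightStable d n k := by
  induction k with
  | zero => exact Mset_one_mul_mem hd hk
  | succ k ih =>
    replace ih := ih (by omega)
    refine Mset_cases (fun m x hx => t_pow_mul_mem hd hk m hx)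
      (fun m x hx => t_pow_bk_mul_mem_of_gens hd hk ih m hx) ?_
    rintro l hl y hy x hx
    obtain ⟨i, h1, h2, rfl⟩ | ⟨i, h1, h2, rfl⟩ | ⟨-, rfl⟩ := hx
    · obtain rfl | h := eq_or_ne i (k + 2)
      · exact g_mul_mul_t_mem hk y hy
      · rw [mul_assoc]
        exact g_mul_mem hk (ih y hy _ (Or.inl ⟨i, h1, by omega, rfl⟩))
    · obtain rfl | h := eq_or_ne i (k + 1)
      · exact g_mul_mul_g_mem hd hk ih y hy
      · rw [mul_assoc]
        exact g_mul_mem hk (ih y hy _ (Or.inr (Or.inl ⟨i, h1, by omega, rfl⟩)))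
    · rw [mul_assoc]
      exact g_mul_mem hk (ih y hy _ (Or.inr (Or.inr ⟨by omega, rfl⟩)))

variable (d n) in
/-- The products `𝔪_1 ⋯ 𝔪_k` with `𝔪_i ∈ M_{d,i}`. -/
def partialProducts (k : ℕ) : Set (YB d n) :=
  {x | ∃ f : Fin k → YB d n, (∀ i : Fin k, f i ∈ Mset d n (i.val + 1)) ∧
    x = (List.ofFn f).prod}

open scoped Pointwise in
lemma partialProducts_mul_subset (k : ℕ) :
    partialProducts d n k * Mset d n (k + 1) ⊆ partialProducts d n (k + 1) := by
  rintro _ ⟨_, ⟨f, hf, rfl⟩, y, hy, rfl⟩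
  refine ⟨Fin.snoc (α := fun _ => YB d n) f y, fun i => ?_, ?_⟩
  · refine Fin.lastCases ?_ (fun i => ?_) i
    · simpa using hy
    · simpa using hf i
  · rw [List.ofFn_succ', List.prod_concat]
    simp

theorem strandAlg_le_span (hd : 1 ≤ d) {k : ℕ} (hk : k ≤ n) :
    Subalgebra.toSubmodule (strandAlg d n k) ≤ Submodule.span Kf (partialProducts d n k) := by
  induction k with
  | zero =>
    have : gens d n 0 = ∅ := by
      ext x; simp only [gens]; constructor
      · rintro (⟨i, h1, h2, -⟩ | ⟨i, h1, h2, -⟩ | ⟨h1, -⟩) <;> omega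
      · exact False.elim
    rw [strandAlg, this, Algebra.adjoin_empty, Algebra.toSubmodule_bot, Submodule.one_eq_span]
    refine Submodule.span_mono ?_
    rintro _ rfl
    exact ⟨Fin.elim0, fun i => i.elim0, by simp⟩
  | succ k ih =>
    have h1 : Subalgebra.toSubmodule (strandAlg d n (k + 1)) ≤ strandMod d n k := fun x hx => by
      have := strandMod_mul_mem (rightStable hd hk) (t_pow_mem_strandMod hd hk 0) hx
      rwa [pow_zero, one_mul] at this
    refine h1.trans ((mul_le_mul' (ih (by omega)) le_rfl).trans ?_)
    rw [Submodule.span_mul_span]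
    exact Submodule.span_mono (partialProducts_mul_subset k)

lemma strandAlg_eq_top (hn : 1 ≤ n) : strandAlg d n n = ⊤ := by
  have h : Function.Surjective (mkY d n) := RingQuot.mkAlgHom_surjective _ _
  rw [eq_top_iff, ← (AlgHom.range_eq_top _).2 h, ← Algebra.map_top, ← FreeAlgebra.adjoin_range_ι,
    AlgHom.map_adjoin]
  refine Algebra.adjoin_le ?_
  rintro _ ⟨_, ⟨x, rfl⟩, rfl⟩
  cases x with
  | b => exact b_mem_strandAlg hn
  | g i =>
    have := g_mem_strandAlg (d := d) (n := n) (i := i + 1) (k := n) (by omega) (by omega)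
    rwa [gY, Gg, dif_pos (by omega)] at this
  | t i =>
    have := t_mem_strandAlg (d := d) (n := n) (i := i + 1) (k := n) (by omega) (by omega)
    rwa [tY, Tt, dif_pos (by omega)] at this

theorem span_Cset (hd : 1 ≤ d) (hn : 1 ≤ n) : Submodule.span Kf (Cset d n) = ⊤ := by
  have := strandAlg_le_span (d := d) (n := n) hd le_rfl
  rw [strandAlg_eq_top hn, Algebra.top_toSubmodule] at this
  exact top_le_iff.1 this

end Spanning

section Representation

/-- Coloured signed permutations of `Fin n`, written as words: the letter in
position `p` consists of a value, a sign (`true` for negative) and a colour. -/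
abbrev Word (d n : ℕ) : Type := Equiv.Perm (Fin n) × (Fin n → Bool × Fin d)

namespace Word

/-- The signed value of the letter in position `p`. -/
def key (x : Word d n) (p : Fin n) : ℤ := (if (x.2 p).1 then -1 else 1) * ((x.1 p : ℕ) + 1 : ℤ)

/-- The colour of the letter in position `p`. -/
def col (x : Word d n) (p : Fin n) : Fin d := (x.2 p).2

/-- Permute the positions of a word. -/
def perm (π : Equiv.Perm (Fin n)) (x : Word d n) : Word d n := (π.trans x.1, x.2 ∘ π)

/-- Change the sign of the letter in position `p`. -/
def negate (p : Fin n) (x : Word d n) : Word d n :=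
  (x.1, Function.update x.2 p (!(x.2 p).1, (x.2 p).2))

@[simp] lemma key_perm (π : Equiv.Perm (Fin n)) (x : Word d n) (p : Fin n) :
    (x.perm π).key p = x.key (π p) := rfl

@[simp] lemma col_perm (π : Equiv.Perm (Fin n)) (x : Word d n) (p : Fin n) :
    (x.perm π).col p = x.col (π p) := rfl

lemma perm_perm (π ρ : Equiv.Perm (Fin n)) (x : Word d n) :
    (x.perm π).perm ρ = x.perm (π * ρ) := rfl

@[simp] lemma perm_one (x : Word d n) : x.perm 1 = x := rfl

@[simp] lemma col_negate (p q : Fin n) (x : Word d n) : (x.negate p).col q = x.col q := by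
  by_cases h : q = p
  · subst h; simp [col, negate]
  · simp [col, negate, h]

lemma key_negate (p q : Fin n) (x : Word d n) :
    (x.negate p).key q = if q = p then -x.key q else x.key q := by
  by_cases h : q = p
  · subst h; cases hb : (x.2 q).1 <;> simp [key, negate, hb]
  · simp [key, negate, h]

@[simp] lemma key_negate_self (p : Fin n) (x : Word d n) : (x.negate p).key p = -x.key p := by
  simp [key_negate]

@[simp] lemma key_negate_of_ne {p q : Fin n} (h : q ≠ p) (x : Word d n) :
    (x.negate p).key q = x.key q := by
  simp [key_negate, h]

@[simp] lemma negate_negate (p : Fin n) (x : Word d n) : (x.negate p).negate p = x := by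
  simp [negate]

lemma negate_comm {p q : Fin n} (h : p ≠ q) (x : Word d n) :
    (x.negate p).negate q = (x.negate q).negate p := by
  simp [negate, h, h.symm, Function.update_comm h]

lemma perm_negate (π : Equiv.Perm (Fin n)) (p : Fin n) (x : Word d n) :
    (x.negate (π p)).perm π = (x.perm π).negate p := by
  refine Prod.ext rfl (funext fun q => ?_)
  by_cases h : q = p
  · subst h; simp [perm, negate]
  · simp [perm, negate, h]

lemma key_ne_zero (x : Word d n) (p : Fin n) : x.key p ≠ 0 := by
  rw [key]; split_ifs <;> omega

lemma key_natAbs_ne {x : Word d n} {p q : Fin n} (h : p ≠ q) :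
    (x.key p).natAbs ≠ (x.key q).natAbs := by
  have : (x.1 p : ℕ) ≠ x.1 q := fun hpq => h (x.1.injective (Fin.ext hpq))
  rw [key, key]; split_ifs <;> omega

lemma key_ne {x : Word d n} {p q : Fin n} (h : p ≠ q) : x.key p ≠ x.key q :=
  fun e => key_natAbs_ne h (congrArg Int.natAbs e)

end Word

open Word

/-- The operator `f ↦ (x ↦ f (x s) + [x_p > x_q, same colours] (u - u⁻¹) f x)` where `s` swaps
the positions `p` and `q`. -/
def opG (p q : Fin n) : Module.End Kf (Word d n → Kf) where
  toFun f x := f (x.perm (Equiv.swap p q)) +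
    (if x.col p = x.col q ∧ x.key q < x.key p then uu - uu⁻¹ else 0) * f x
  map_add' f g := by ext x; simp only [Pi.add_apply]; ring
  map_smul' c f := by
    ext x; simp only [Pi.smul_apply, smul_eq_mul, RingHom.id_apply]; ring

/-- The operator `f ↦ (x ↦ f (x s) + [x_p < 0, colour 0] (v - v⁻¹) f x)` where `s` flips the sign
in position `p`. -/
def opB (p : Fin n) : Module.End Kf (Word d n → Kf) where
  toFun f x := f (x.negate p) +
    (if (x.col p : ℕ) = 0 ∧ x.key p < 0 then vv - vv⁻¹ else 0) * f x
  map_add' f g := by ext x; simp only [Pi.add_apply]; ring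
  map_smul' c f := by
    ext x; simp only [Pi.smul_apply, smul_eq_mul, RingHom.id_apply]; ring

/-- The diagonal operator multiplying by `ζ` to the power of the colour in position `p`. -/
def opT (ζ : Kf) (p : Fin n) : Module.End Kf (Word d n → Kf) :=
  LinearMap.mulLeft Kf fun x => ζ ^ (x.col p : ℕ)

lemma opG_apply (p q : Fin n) (f : Word d n → Kf) (x : Word d n) :
    opG p q f x = f (x.perm (Equiv.swap p q)) +
      (if x.col p = x.col q ∧ x.key q < x.key p then uu - uu⁻¹ else 0) * f x := rfl

lemma opB_apply (p : Fin n) (f : Word d n → Kf) (x : Word d n) :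
    opB p f x = f (x.negate p) +
      (if (x.col p : ℕ) = 0 ∧ x.key p < 0 then vv - vv⁻¹ else 0) * f x := rfl

lemma opT_apply (ζ : Kf) (p : Fin n) (f : Word d n → Kf) (x : Word d n) :
    opT ζ p f x = ζ ^ (x.col p : ℕ) * f x := rfl

lemma opT_pow_apply (ζ : Kf) (p : Fin n) (m : ℕ) (f : Word d n → Kf) (x : Word d n) :
    (opT ζ p ^ m) f x = (ζ ^ (x.col p : ℕ)) ^ m * f x := by
  rw [opT, LinearMap.pow_mulLeft]; rfl

lemma opG_comm {p q r s : Fin n} (hpr : p ≠ r) (hps : p ≠ s) (hqr : q ≠ r) (hqs : q ≠ s) :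
    opG (d := d) p q * opG r s = opG r s * opG p q := by
  have hc : Equiv.swap p q * Equiv.swap r s = Equiv.swap r s * Equiv.swap p q :=
    (Equiv.Perm.disjoint_iff_disjoint_support.2 (by
      by_cases h : p = q
      · simp [h]
      by_cases h' : r = s
      · simp [h']
      simp [Equiv.Perm.support_swap h, Equiv.Perm.support_swap h', hpr.symm,
        hps.symm, hqr.symm, hqs.symm])).commute.eq
  refine LinearMap.ext fun f => funext fun x => ?_
  simp only [Module.End.mul_apply, opG_apply, perm_perm, hc, key_perm, col_perm,
    Equiv.swap_apply_of_ne_of_ne hpr hps, Equiv.swap_apply_of_ne_of_ne hqr hqs,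
    Equiv.swap_apply_of_ne_of_ne hpr.symm hqr.symm, Equiv.swap_apply_of_ne_of_ne hps.symm hqs.symm]
  ring

lemma opG_braid {p q r : Fin n} (hpq : p ≠ q) (hpr : p ≠ r) (hqr : q ≠ r) :
    opG (d := d) p q * opG q r * opG p q = opG q r * opG p q * opG q r := by
  have hb : Equiv.swap p q * (Equiv.swap q r * Equiv.swap p q) =
      Equiv.swap q r * (Equiv.swap p q * Equiv.swap q r) := by
    rw [← mul_assoc, ← mul_assoc, Equiv.swap_mul_swap_mul_swap hpq hpr,
      Equiv.swap_comm p q, Equiv.swap_comm q r,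
      Equiv.swap_mul_swap_mul_swap hqr.symm hpr.symm, Equiv.swap_comm]
  refine LinearMap.ext fun f => funext fun x => ?_
  have kpq := key_ne (x := x) hpq
  have kpr := key_ne (x := x) hpr
  have kqr := key_ne (x := x) hqr
  have spp : Equiv.swap p q * Equiv.swap p q = 1 := Equiv.swap_mul_self p q
  have sqq : Equiv.swap q r * Equiv.swap q r = 1 := Equiv.swap_mul_self q r
  simp only [Module.End.mul_apply, opG_apply, perm_perm, mul_assoc, hb, key_perm, col_perm,
    Equiv.swap_apply_of_ne_of_ne hpq hpr, Equiv.swap_apply_of_ne_of_ne hpr.symm hqr.symm,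
    Equiv.swap_apply_left, Equiv.swap_apply_right, Equiv.Perm.mul_apply, spp, sqq, perm_one]
  generalize x.key p = a at *
  generalize x.key q = b at *
  generalize x.key r = c at *
  generalize x.col p = α at *
  generalize x.col q = β at *
  generalize x.col r = γ at *
  simp only [eq_comm (a := β) (b := α), eq_comm (a := γ) (b := β)]
  generalize uu - uu⁻¹ = u
  by_cases h1 : α = β <;> by_cases h2 : β = γ <;> by_cases h3 : α = γ <;>
  first
  | (exfalso; omega)
  | skip
  all_goals
    rcases lt_or_gt_of_ne kpq with h4 | h4 <;> rcases lt_or_gt_of_ne kpr with h5 | h5 <;>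
    rcases lt_or_gt_of_ne kqr with h6 | h6 <;>
    first
    | (exfalso; omega)
    | (simp only [h1, h2, h3, h4, h5, h6, h4.not_gt, h5.not_gt, h6.not_gt, and_true, and_false,
        eq_comm (a := γ) (b := β), if_true, if_false]; ring)

lemma opB_opG_comm {p q r : Fin n} (hpq : p ≠ q) (hpr : p ≠ r) :
    opB (d := d) p * opG q r = opG q r * opB p := by
  have hp : Equiv.swap q r p = p := Equiv.swap_apply_of_ne_of_ne hpq hpr
  refine LinearMap.ext fun f => funext fun x => ?_
  have hf : (x.perm (Equiv.swap q r)).negate p = (x.negate p).perm (Equiv.swap q r) := by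
    rw [← perm_negate, hp]
  simp only [Module.End.mul_apply, opG_apply, opB_apply, key_perm, col_perm, col_negate, hp, hf,
    key_negate_of_ne hpq.symm, key_negate_of_ne hpr.symm]
  ring

lemma opB_opG_reflection {p q : Fin n} (hpq : p ≠ q) :
    opB (d := d) p * opG p q * opB p * opG p q = opG p q * opB p * opG p q * opB p := by
  refine LinearMap.ext fun f => funext fun x => ?_
  have k := key_natAbs_ne (x := x) hpq
  have k0 := key_ne_zero x p
  have k1 := key_ne_zero x q
  have hs : Equiv.swap p q * Equiv.swap p q = 1 := Equiv.swap_mul_self p q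
  have hp (y : Word d n) :
      (y.perm (Equiv.swap p q)).negate p = (y.negate q).perm (Equiv.swap p q) := by
    rw [← perm_negate, Equiv.swap_apply_left]
  simp only [Module.End.mul_apply, opG_apply, opB_apply, perm_perm, key_perm, col_perm, hp,
    Equiv.swap_apply_left, Equiv.swap_apply_right, hs, perm_one, negate_negate, negate_comm hpq,
    col_negate, key_negate_self, key_negate_of_ne hpq.symm, key_negate_of_ne hpq]
  generalize x.key p = a at *
  generalize x.key q = b at *
  generalize x.col p = α at *
  generalize x.col q = β at *
  have e1 : b < a ↔ ¬ a < b := by omega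
  have e2 : b < -a ↔ a < -b := by omega
  have e3 : -a < b ↔ ¬ a < -b := by omega
  have e4 : -a < 0 ↔ ¬ a < 0 := by omega
  have e5 : -b < 0 ↔ ¬ b < 0 := by omega
  simp only [eq_comm (a := β) (b := α), neg_lt_neg_iff, e1, e2, e3, e4, e5]
  generalize uu - uu⁻¹ = u
  generalize vv - vv⁻¹ = v
  by_cases h1 : α = β <;> by_cases h2 : (α : ℕ) = 0 <;>
    by_cases h3 : (β : ℕ) = 0 <;> by_cases h4 : a < 0 <;> by_cases h5 : b < 0 <;>
    by_cases h6 : a < b <;> by_cases h7 : a < -b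
  all_goals first
    | (exfalso; omega)
    | (simp only [*, not_true, not_false_iff, and_true, and_false, if_true, if_false]
       ring)

lemma sum_range_pow_of_pow_eq_one {z : Kf} (hz : z ^ d = 1) :
    ∑ m ∈ range d, z ^ m = if z = 1 then (d : Kf) else 0 := by
  split_ifs with h
  · simp [h]
  · have := geom_sum_mul z d
    rw [hz, sub_self] at this
    exact (mul_eq_zero.1 this).resolve_right (sub_ne_zero.2 h)

variable (d n) in
/-- The idempotent `e_i` acts by the operator `opE`. -/
def opE (ζ : Kf) (p q : Fin n) : Module.End Kf (Word d n → Kf) :=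
  (d : Kf)⁻¹ • ∑ m ∈ range d, opT ζ p ^ m * opT ζ q ^ (d - m)

variable (d n) in
/-- The idempotent `f_1` acts by the operator `opF`. -/
def opF (ζ : Kf) (p : Fin n) : Module.End Kf (Word d n → Kf) :=
  (d : Kf)⁻¹ • ∑ m ∈ range d, opT ζ p ^ m

lemma opE_apply (hd : 1 ≤ d) {ζ : Kf} (hζ : IsPrimitiveRoot ζ d) (p q : Fin n)
    (f : Word d n → Kf) (x : Word d n) :
    opE d n ζ p q f x = if x.col p = x.col q then f x else 0 := by
  have hd' : (d : Kf) ≠ 0 := Nat.cast_ne_zero.2 (by omega)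
  have hζ0 : ζ ≠ 0 := hζ.ne_zero (by omega)
  have h1 (a : ℕ) : (ζ ^ a) ^ d = 1 := by rw [← pow_mul, mul_comm, pow_mul, hζ.pow_eq_one, one_pow]
  have h2 : ζ ^ (x.col p : ℕ) / ζ ^ (x.col q : ℕ) = 1 ↔ x.col p = x.col q := by
    rw [div_eq_one_iff_eq (pow_ne_zero _ hζ0)]
    exact ⟨fun h => Fin.ext (hζ.pow_inj (x.col p).2 (x.col q).2 h), fun h => h ▸ rfl⟩
  have h3 : ∀ m ∈ range d, (ζ ^ (x.col p : ℕ)) ^ m * ((ζ ^ (x.col q : ℕ)) ^ (d - m) * f x) =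
      (ζ ^ (x.col p : ℕ) / ζ ^ (x.col q : ℕ)) ^ m * f x := by
    intro m hm
    rw [pow_sub₀ _ (pow_ne_zero _ hζ0) (mem_range.1 hm).le, h1, div_pow]
    ring
  simp only [opE, LinearMap.smul_apply, LinearMap.sum_apply, Module.End.mul_apply, Pi.smul_apply,
    Finset.sum_apply, opT_pow_apply, smul_eq_mul]
  rw [sum_congr rfl h3, ← sum_mul, sum_range_pow_of_pow_eq_one (by rw [div_pow, h1, h1, div_one])]
  simp only [h2]
  split_ifs
  · rw [← mul_assoc, inv_mul_cancel₀ hd', one_mul]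
  · simp

lemma opF_apply (hd : 1 ≤ d) {ζ : Kf} (hζ : IsPrimitiveRoot ζ d) (p : Fin n)
    (f : Word d n → Kf) (x : Word d n) :
    opF d n ζ p f x = if (x.col p : ℕ) = 0 then f x else 0 := by
  have hd' : (d : Kf) ≠ 0 := Nat.cast_ne_zero.2 (by omega)
  have h1 : (ζ ^ (x.col p : ℕ)) ^ d = 1 := by
    rw [← pow_mul, mul_comm, pow_mul, hζ.pow_eq_one, one_pow]
  have h2 : ζ ^ (x.col p : ℕ) = 1 ↔ (x.col p : ℕ) = 0 :=
    ⟨fun h => hζ.pow_inj (x.col p).2 (by omega) (by simpa using h), fun h => by rw [h, pow_zero]⟩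
  simp only [opF, LinearMap.smul_apply, LinearMap.sum_apply, Pi.smul_apply,
    Finset.sum_apply, opT_pow_apply, smul_eq_mul]
  rw [← sum_mul, sum_range_pow_of_pow_eq_one h1]
  simp only [h2]
  split_ifs
  · rw [← mul_assoc, inv_mul_cancel₀ hd', one_mul]
  · simp

lemma opG_sq (hd : 1 ≤ d) {ζ : Kf} (hζ : IsPrimitiveRoot ζ d) {p q : Fin n} (hpq : p ≠ q) :
    opG p q ^ 2 = 1 + (uu - uu⁻¹) • (opE d n ζ p q * opG p q) := by
  refine LinearMap.ext fun f => funext fun x => ?_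
  have k := key_ne (x := x) hpq
  have hs : Equiv.swap p q * Equiv.swap p q = 1 := Equiv.swap_mul_self p q
  simp only [pow_two, Module.End.mul_apply, LinearMap.add_apply, LinearMap.smul_apply,
    Module.End.one_apply, Pi.add_apply, Pi.smul_apply, smul_eq_mul, opE_apply hd hζ, opG_apply,
    perm_perm, hs, perm_one, key_perm, col_perm, Equiv.swap_apply_left, Equiv.swap_apply_right]
  simp only [eq_comm (a := x.col q) (b := x.col p)]
  by_cases h1 : x.col p = x.col q <;> rcases lt_or_gt_of_ne k with h2 | h2 <;>
    simp only [h1, h2, h2.not_gt, and_true, and_false, if_true, if_false] <;> ring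

lemma opB_sq (hd : 1 ≤ d) {ζ : Kf} (hζ : IsPrimitiveRoot ζ d) (p : Fin n) :
    opB p ^ 2 = 1 + (vv - vv⁻¹) • (opF d n ζ p * opB p) := by
  refine LinearMap.ext fun f => funext fun x => ?_
  have k := key_ne_zero x p
  simp only [pow_two, Module.End.mul_apply, LinearMap.add_apply, LinearMap.smul_apply,
    Module.End.one_apply, Pi.add_apply, Pi.smul_apply, smul_eq_mul, opF_apply hd hζ, opB_apply,
    negate_negate, key_negate_self, col_negate, Left.neg_neg_iff]
  by_cases h1 : (x.col p : ℕ) = 0 <;> rcases lt_or_gt_of_ne k with h2 | h2 <;>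
    simp only [h1, h2, h2.not_gt, and_true, and_false, if_true, if_false] <;> ring

lemma opT_comm (ζ : Kf) (p q : Fin n) : opT (d := d) ζ p * opT ζ q = opT ζ q * opT ζ p := by
  refine LinearMap.ext fun f => funext fun x => ?_
  simp only [Module.End.mul_apply, opT_apply]
  ring

lemma opT_opG (ζ : Kf) (p q r : Fin n) :
    opT (d := d) ζ r * opG p q = opG p q * opT ζ (Equiv.swap p q r) := by
  refine LinearMap.ext fun f => funext fun x => ?_
  simp only [Module.End.mul_apply, opT_apply, opG_apply, col_perm, Equiv.swap_apply_self]
  split_ifs with h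
  · have : x.col (Equiv.swap p q r) = x.col r := by
      rw [Equiv.swap_apply_def]; split_ifs with h1 h2
      · rw [h1, h.1]
      · rw [h2, h.1]
      · rfl
    rw [this]; ring
  · ring

lemma opT_opB (ζ : Kf) (p q : Fin n) : opT (d := d) ζ q * opB p = opB p * opT ζ q := by
  refine LinearMap.ext fun f => funext fun x => ?_
  simp only [Module.End.mul_apply, opT_apply, opB_apply, col_negate]
  ring

lemma opT_pow_d {ζ : Kf} (hζ : ζ ^ d = 1) (p : Fin n) : opT (d := d) ζ p ^ d = 1 := by
  refine LinearMap.ext fun f => funext fun x => ?_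
  rw [opT_pow_apply, ← pow_mul, mul_comm (x.col p : ℕ), pow_mul, hζ, one_pow, one_mul]
  rfl

/-- The action of the free algebra on functions on coloured signed permutations. -/
def freeRep (hn : 0 < n) (ζ : Kf) : FA n →ₐ[Kf] Module.End Kf (Word d n → Kf) :=
  FreeAlgebra.lift Kf fun
    | Gen.b => opB ⟨0, hn⟩
    | Gen.g i => opG ⟨i, by omega⟩ ⟨i + 1, by omega⟩
    | Gen.t j => opT ζ j

section FreeRep

variable (hn : 0 < n) (ζ : Kf)

lemma freeRep_Bb : freeRep (d := d) hn ζ (Bb n) = opB ⟨0, hn⟩ := by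
  simp [freeRep, Bb]

lemma freeRep_Gg {i : ℕ} (hi : 1 ≤ i) (hi' : i ≤ n - 1) :
    freeRep (d := d) hn ζ (Gg n i) = opG ⟨i - 1, by omega⟩ ⟨i, by omega⟩ := by
  rw [Gg, dif_pos ⟨hi, hi'⟩]
  simp only [freeRep, FreeAlgebra.lift_ι_apply, Nat.sub_add_cancel hi]

lemma freeRep_Tt {j : ℕ} (hj : 1 ≤ j) (hj' : j ≤ n) :
    freeRep (d := d) hn ζ (Tt n j) = opT ζ ⟨j - 1, by omega⟩ := by
  rw [Tt, dif_pos ⟨hj, hj'⟩]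
  simp only [freeRep, FreeAlgebra.lift_ι_apply]

lemma freeRep_eF {i : ℕ} (hi : 1 ≤ i) (hi' : i ≤ n - 1) :
    freeRep hn ζ (eF d n i) = opE d n ζ ⟨i - 1, by omega⟩ ⟨i, by omega⟩ := by
  simp only [eF, opE, map_smul, map_sum, map_mul, map_pow]
  rw [freeRep_Tt hn ζ hi (by omega), freeRep_Tt hn ζ (by omega : 1 ≤ i + 1) (by omega)]
  rfl

lemma freeRep_fF : freeRep hn ζ (fF d n) = opF d n ζ ⟨0, hn⟩ := by
  simp only [fF, opF, map_smul, map_sum, map_pow]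
  rw [freeRep_Tt hn ζ le_rfl hn]

variable {ζ}

lemma freeRep_rel (hd : 1 ≤ d) (hn2 : 2 ≤ n) (hζ : IsPrimitiveRoot ζ d) {a b : FA n}
    (h : YBrel d n a b) : freeRep (d := d) hn ζ a = freeRep hn ζ b := by
  cases h with
  | gg i j hi hi' hj hj' hij =>
    rw [map_mul, map_mul, freeRep_Gg hn ζ hi hi', freeRep_Gg hn ζ hj hj']
    apply opG_comm <;> rw [Ne, Fin.mk.injEq] <;> omega
  | braid i hi hi' =>
    simp only [map_mul, freeRep_Gg hn ζ hi (by omega),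
      freeRep_Gg hn ζ (by omega : 1 ≤ i + 1) (by omega)]
    apply opG_braid <;> rw [Ne, Fin.mk.injEq] <;> omega
  | bg i hi hi' =>
    rw [map_mul, map_mul, freeRep_Gg hn ζ (by omega) hi', freeRep_Bb]
    apply opB_opG_comm <;> rw [Ne, Fin.mk.injEq] <;> omega
  | bgbg =>
    simp only [map_mul, freeRep_Gg hn ζ le_rfl (by omega : 1 ≤ n - 1), freeRep_Bb]
    apply opB_opG_reflection
    rw [Ne, Fin.mk.injEq]; omega
  | tt i j hi hi' hj hj' =>
    rw [map_mul, map_mul, freeRep_Tt hn ζ hi hi', freeRep_Tt hn ζ hj hj', opT_comm]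
  | tg i j hi hi' hj hj' =>
    have hs : 1 ≤ sAct i j ∧ sAct i j ≤ n := by
      rw [sAct]; split_ifs <;> omega
    rw [map_mul, map_mul, freeRep_Tt hn ζ hj hj', freeRep_Tt hn ζ hs.1 hs.2,
      freeRep_Gg hn ζ hi hi', opT_opG]
    congr 2
    rw [Equiv.swap_apply_def]
    simp only [sAct, Fin.mk.injEq]
    split_ifs <;> first | omega | (rw [Fin.mk.injEq]; omega)
  | tb i hi hi' =>
    rw [map_mul, map_mul, freeRep_Tt hn ζ hi hi', freeRep_Bb, opT_opB]
  | td i hi hi' =>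
    rw [map_pow, freeRep_Tt hn ζ hi hi', opT_pow_d hζ.pow_eq_one, map_one]
  | gsq i hi hi' =>
    rw [map_pow, map_add, map_smul, map_mul, map_one, freeRep_Gg hn ζ hi hi',
      freeRep_eF hn ζ hi hi']
    apply opG_sq hd hζ
    rw [Ne, Fin.mk.injEq]; omega
  | bsq =>
    rw [map_pow, map_add, map_smul, map_mul, map_one, freeRep_Bb, freeRep_fF]
    exact opB_sq hd hζ _

end FreeRep

/-- The action of `Y_{d,n}^B` on functions on coloured signed permutations. -/
def rep (hd : 1 ≤ d) (hn : 2 ≤ n) {ζ : Kf} (hζ : IsPrimitiveRoot ζ d) :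
    YB d n →ₐ[Kf] Module.End Kf (Word d n → Kf) :=
  RingQuot.liftAlgHom Kf ⟨freeRep (by omega) ζ, fun _ _ h => freeRep_rel _ hd hn hζ h⟩

lemma rep_mkY (hd : 1 ≤ d) (hn : 2 ≤ n) {ζ : Kf} (hζ : IsPrimitiveRoot ζ d) (a : FA n) :
    rep hd hn hζ (mkY d n a) = freeRep (by omega) ζ a :=
  RingQuot.liftAlgHom_mkAlgHom_apply _ _ _ _

end Representation

section LinearIndependence

open Word

/-- The sum of the words with identity underlying permutation and positive letters. -/
def baseVector : Word d n → Kf := fun x => if x.1 = 1 ∧ ∀ p, (x.2 p).1 = false then 1 else 0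

lemma word_induction {P : Word d n → Prop} (hn : 0 < n)
    (hbase : ∀ c : Fin n → Fin d, P (1, fun p => (false, c p)))
    (hperm : ∀ i (hi : i + 1 < n) x, P x → P (x.perm (Equiv.swap ⟨i, by omega⟩ ⟨i + 1, hi⟩)))
    (hneg : ∀ x, P x → P (x.negate ⟨0, hn⟩)) (x : Word d n) : P x := by
  have hperm' (π : Equiv.Perm (Fin n)) : ∀ x, P x → P (x.perm π) := by
    obtain ⟨m, rfl⟩ : ∃ m, n = m + 1 := ⟨n - 1, by omega⟩
    have hπ : π ∈ Submonoid.closure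
        (Set.range fun i : Fin m => Equiv.swap i.castSucc i.succ) := by
      rw [Equiv.Perm.mclosure_swap_castSucc_succ]; trivial
    induction hπ using Submonoid.closure_induction with
    | mem π hπ =>
      obtain ⟨i, rfl⟩ := hπ
      exact hperm i (by omega)
    | one => exact fun x hx => hx
    | mul π ρ _ _ h1 h2 => exact fun x hx => h2 _ (h1 _ hx)
  have hneg' (p : Fin n) (x : Word d n) (hx : P x) : P (x.negate p) := by
    have h := hneg _ (hperm' (Equiv.swap p ⟨0, hn⟩) x hx)
    rw [← perm_negate, Equiv.swap_apply_right] at h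
    have := hperm' (Equiv.swap p ⟨0, hn⟩) _ h
    rwa [perm_perm, Equiv.swap_mul_self, perm_one] at this
  obtain ⟨σ, w⟩ := x
  have hw (s : Finset (Fin n)) : P (σ, fun p => (decide (p ∈ s), (w p).2)) := by
    induction s using Finset.induction_on with
    | empty =>
      have h := hperm' σ _ (hbase fun p => (w (σ⁻¹ p)).2)
      convert h using 1
      refine Prod.ext rfl (funext fun p => ?_)
      simp [perm]
    | insert q s hq ih =>
      convert hneg' q _ ih using 1
      refine Prod.ext rfl (funext fun p => ?_)
      by_cases h : p = q
      · subst h; simp [negate, hq]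
      · simp [negate, h]
  convert hw (univ.filter fun p => (w p).1 = true) using 2
  ext p <;> simp

lemma opG_single (p q : Fin n) (x : Word d n) : opG p q (Pi.single x 1) =
    Pi.single (x.perm (Equiv.swap p q)) 1 +
      (if x.col p = x.col q ∧ x.key q < x.key p then uu - uu⁻¹ else 0) • Pi.single x 1 := by
  refine funext fun y => ?_
  have h : y.perm (Equiv.swap p q) = x ↔ y = x.perm (Equiv.swap p q) := by
    constructor <;> rintro rfl <;> rw [perm_perm, Equiv.swap_mul_self, perm_one]
  simp only [opG_apply, Pi.add_apply, Pi.smul_apply, Pi.single_apply, h, smul_eq_mul]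
  by_cases hy : y = x
  · subst hy; rfl
  · simp [hy]

lemma opB_single (p : Fin n) (x : Word d n) : opB p (Pi.single x 1) =
    Pi.single (x.negate p) 1 +
      (if (x.col p : ℕ) = 0 ∧ x.key p < 0 then vv - vv⁻¹ else 0) • Pi.single x 1 := by
  refine funext fun y => ?_
  have h : y.negate p = x ↔ y = x.negate p := by
    constructor <;> rintro rfl <;> rw [negate_negate]
  simp only [opB_apply, Pi.add_apply, Pi.smul_apply, Pi.single_apply, h, smul_eq_mul]
  by_cases hy : y = x
  · subst hy; rfl
  · simp [hy]

lemma sum_opT_eq_indicator (hd : 1 ≤ d) {ζ : Kf} (hζ : IsPrimitiveRoot ζ d) (p : Fin n)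
    (a : Fin d) (f : Word d n → Kf) :
    (d : Kf)⁻¹ • ∑ m ∈ range d, (ζ ^ (a : ℕ))⁻¹ ^ m • (opT ζ p ^ m) f =
      fun x => if x.col p = a then f x else 0 := by
  have hd' : (d : Kf) ≠ 0 := Nat.cast_ne_zero.2 (by omega)
  have hζ0 : ζ ≠ 0 := hζ.ne_zero (by omega)
  have h1 (a : ℕ) : (ζ ^ a) ^ d = 1 := by
    rw [← pow_mul, mul_comm, pow_mul, hζ.pow_eq_one, one_pow]
  refine funext fun x => ?_
  have h2 : ζ ^ (x.col p : ℕ) / ζ ^ (a : ℕ) = 1 ↔ x.col p = a := by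
    rw [div_eq_one_iff_eq (pow_ne_zero _ hζ0)]
    exact ⟨fun h => Fin.ext (hζ.pow_inj (x.col p).2 a.2 h), fun h => h ▸ rfl⟩
  have h3 : ∀ m ∈ range d, (ζ ^ (a : ℕ))⁻¹ ^ m * ((ζ ^ (x.col p : ℕ)) ^ m * f x) =
      (ζ ^ (x.col p : ℕ) / ζ ^ (a : ℕ)) ^ m * f x := fun m _ => by
    rw [div_eq_mul_inv, mul_pow]; ring
  simp only [Pi.smul_apply, Finset.sum_apply, opT_pow_apply, smul_eq_mul]
  rw [sum_congr rfl h3, ← sum_mul, sum_range_pow_of_pow_eq_one (by rw [div_pow, h1, h1, div_one])]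
  simp only [h2]
  split_ifs
  · rw [← mul_assoc, inv_mul_cancel₀ hd', one_mul]
  · simp

section Cyclic

variable {ζ : Kf} (hd : 1 ≤ d) (hn : 2 ≤ n) (hζ : IsPrimitiveRoot ζ d)

/-- The orbit map of `baseVector`. -/
def orbitMap : YB d n →ₗ[Kf] (Word d n → Kf) :=
  LinearMap.applyₗ baseVector ∘ₗ (rep hd hn hζ).toLinearMap

lemma rep_mem_range {f : Word d n → Kf} (a : FA n) (hf : f ∈ (orbitMap hd hn hζ).range) :
    freeRep (by omega) ζ a f ∈ (orbitMap hd hn hζ).range := by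
  obtain ⟨y, rfl⟩ := hf
  refine ⟨mkY d n a * y, ?_⟩
  simp [orbitMap, rep_mkY]

lemma opT_pow_mem_range {f : Word d n → Kf} (p : Fin n) (m : ℕ)
    (hf : f ∈ (orbitMap hd hn hζ).range) :
    (opT ζ p ^ m) f ∈ (orbitMap hd hn hζ).range := by
  have := rep_mem_range hd hn hζ (Tt n (p + 1) ^ m) hf
  rwa [map_pow, freeRep_Tt _ _ (by omega) (by omega)] at this

lemma indicator_mem_range (c : Fin n → Fin d) (s : Finset (Fin n)) :
    (fun x : Word d n => if ∀ p ∈ s, x.col p = c p then baseVector x else 0) ∈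
      (orbitMap hd hn hζ).range := by
  induction s using Finset.induction_on with
  | empty => exact ⟨1, by simp [orbitMap]⟩
  | insert p s _ ih =>
    have := Submodule.smul_mem _ (d : Kf)⁻¹ (sum_mem fun m (_ : m ∈ range d) =>
      Submodule.smul_mem _ ((ζ ^ (c p : ℕ))⁻¹ ^ m) (opT_pow_mem_range hd hn hζ p m ih))
    rw [sum_opT_eq_indicator hd hζ] at this
    simpa only [Finset.forall_mem_insert, ite_and] using this

lemma single_mem_range (x : Word d n) : Pi.single x 1 ∈ (orbitMap hd hn hζ).range := by
  refine word_induction (P := fun x => Pi.single x 1 ∈ (orbitMap hd hn hζ).range) (by omega)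
    (fun c => ?_) (fun i hi x hx => ?_) (fun x hx => ?_) x
  · convert indicator_mem_range hd hn hζ c univ using 1
    refine funext fun y => ?_
    have : y = (1, fun p => (false, c p)) ↔
        (∀ p ∈ univ, y.col p = c p) ∧ y.1 = 1 ∧ ∀ p, (y.2 p).1 = false := by
      simp only [Prod.ext_iff, funext_iff, col, mem_univ, forall_const, forall_and]
      tauto
    simp only [Pi.single_apply, this, baseVector, ite_and]
  · have := rep_mem_range hd hn hζ (Gg n (i + 1)) hx
    rw [freeRep_Gg _ _ (by omega) (by omega), opG_single] at this
    exact (Submodule.add_mem_iff_left _ (Submodule.smul_mem _ _ hx)).1 this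
  · have := rep_mem_range hd hn hζ (Bb n) hx
    rw [freeRep_Bb, opB_single] at this
    exact (Submodule.add_mem_iff_left _ (Submodule.smul_mem _ _ hx)).1 this

lemma orbitMap_surjective : Function.Surjective (orbitMap hd hn hζ) := by
  rw [← LinearMap.range_eq_top, eq_top_iff, ← (Pi.basisFun Kf (Word d n)).span_eq,
    Submodule.span_le]
  rintro _ ⟨x, rfl⟩
  rw [Pi.basisFun_apply]
  exact single_mem_range hd hn hζ x

end Cyclic

lemma exists_isPrimitiveRoot (hd : 1 ≤ d) : ∃ ζ : Kf, IsPrimitiveRoot ζ d :=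
  ⟨_, (Complex.isPrimitiveRoot_exp d (by omega)).map_of_injective (algebraMap ℂ Kf).injective⟩

variable (d n) in
/-- `M_{d,k}` is covered by a set of at most `2dk` elements. -/
lemma exists_finset_Mset (hd : 1 ≤ d) (k : ℕ) :
    ∃ s : Finset (YB d n), Mset d n (k + 1) ⊆ s ∧ #s ≤ 2 * d * (k + 1) := by
  classical
  have hcard (x : YB d n) (y : YB d n) :
      #((range d).image (x ^ ·) ∪ (range d).image (x ^ · * y)) ≤ 2 * d := by
    have h (f : ℕ → YB d n) : #((range d).image f) ≤ d := by
      simpa using card_image_le (s := range d) (f := f)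
    have := card_union_le ((range d).image (x ^ ·)) ((range d).image (x ^ · * y))
    have := h (x ^ ·)
    have := h (x ^ · * y)
    omega
  have hmem {x y z : YB d n} (h : ∃ m ≤ d - 1, z = x ^ m ∨ z = x ^ m * y) :
      z ∈ (range d).image (x ^ ·) ∪ (range d).image (x ^ · * y) := by
    obtain ⟨m, hm, rfl | rfl⟩ := h
    · exact mem_union_left _ (mem_image.2 ⟨m, mem_range.2 (by omega), rfl⟩)
    · exact mem_union_right _ (mem_image.2 ⟨m, mem_range.2 (by omega), rfl⟩)
  induction k with
  | zero => exact ⟨_, fun z hz => hmem hz, by simpa using hcard _ _⟩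
  | succ k ih =>
    obtain ⟨s, hs, hs'⟩ := ih
    refine ⟨_ ∪ s.image (gY d n (k + 1) * ·), ?_, (card_union_le _ _).trans
      ((add_le_add (hcard (tY d n (k + 2)) (bk d n (k + 2))) (card_image_le.trans hs')).trans ?_)⟩
    · rintro z (hz | ⟨y, hy, rfl⟩)
      · exact mem_union_left _ (hmem hz)
      · exact mem_union_right _ (mem_image_of_mem _ (hs hy))
    · exact le_of_eq (by ring)

variable (d n) in
lemma exists_finset_Cset (hd : 1 ≤ d) :
    ∃ s : Finset (YB d n), Cset d n ⊆ s ∧ #s ≤ Fintype.card (Word d n) := by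
  classical
  choose s hs hs' using exists_finset_Mset d n hd
  refine ⟨(Fintype.piFinset fun i : Fin n => s i).image fun f => (List.ofFn f).prod, ?_, ?_⟩
  · rintro _ ⟨f, hf, rfl⟩
    exact mem_image_of_mem _ (Fintype.mem_piFinset.2 fun i => hs i (hf i))
  · refine card_image_le.trans ?_
    rw [Fintype.card_piFinset]
    refine (prod_le_prod (fun _ _ => Nat.zero_le _) fun (i : Fin n) _ => hs' i).trans (le_of_eq ?_)
    rw [prod_mul_distrib, Fin.prod_univ_eq_prod_range (fun i => i + 1),
      prod_range_add_one_eq_factorial]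
    simp [Fintype.card_perm, mul_comm]

theorem linearIndependent_Cset (hd : 1 ≤ d) (hn : 2 ≤ n) :
    LinearIndependent Kf ((↑) : (Cset d n) → YB d n) := by
  obtain ⟨ζ, hζ⟩ := exists_isPrimitiveRoot hd
  obtain ⟨s, hs, hs'⟩ := exists_finset_Cset d n hd
  have hfin : (Cset d n).Finite := s.finite_toSet.subset hs
  have hspan := span_Cset hd (by omega : 1 ≤ n)
  have : Module.Finite Kf (YB d n) := ⟨⟨hfin.toFinset, by rw [hfin.coe_toFinset, hspan]⟩⟩
  have : Fintype (Cset d n) := hfin.fintype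
  rw [linearIndependent_iff_card_le_finrank_span, Subtype.range_coe, Set.finrank, hspan,
    finrank_top]
  calc Fintype.card (Cset d n) = (Cset d n).ncard := by rw [Set.ncard_eq_toFinset_card',
        Set.toFinset_card]
    _ ≤ #s := (Set.ncard_le_ncard hs s.finite_toSet).trans (Set.ncard_coe_finset s).le
    _ ≤ Module.finrank Kf (Word d n → Kf) := by rwa [Module.finrank_fintype_fun_eq_card]
    _ ≤ Module.finrank Kf (YB d n) :=
      LinearMap.finrank_le_finrank_of_surjective (orbitMap_surjective hd hn hζ)

end LinearIndependence

end YB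

/-- the set `𝖢_n` is a `K`-linear basis of `Y_{d,n}^B`. -/
theorem stmt10 (d n : ℕ) (hd : 1 ≤ d) (hn : 2 ≤ n) :
    LinearIndependent Kf ((↑) : (Cset d n) → YB d n) ∧
    Submodule.span Kf (Cset d n) = ⊤ :=
  ⟨YB.linearIndependent_Cset hd hn, YB.span_Cset hd (by omega)⟩
end
end

section
/- In Y_{d,n}^B the following identities hold: (i) 𝔪^−_{k,j,m} b_k = b_{k−1} 𝔪^−_{k,j,m} for 2 ≤ k ≤ n, j ≤ k−1 and 0 ≤ m ≤ d−1; (ii) for every X ∈ Y_{d,n}^B, g_{n−1} X g_{n−1}^{−1} = g_{n−1}^{−1} X g_{n−1} + (u − u^{−1})(e_{n−1} X g_{n−1} − g_{n−1} X e_{n−1}); (iii) g_{k−1}^2 b_{k−1} g_{k−1}^{−1} = b_{k−1} g_{k−1} − (u − u^{−1}) b_{k−1} e_{k−1} + (u − u^{−1}) e_{k−1} b_k for 2 ≤ k ≤ n. -/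
noncomputable section

section Aux

variable {R : Type*} [Ring R]

theorem sum_range_pow_mul_pow_comm {x y : R} (hxy : x * y = y * x) {d : ℕ}
    (hx : x ^ d = 1) (hy : y ^ d = 1) :
    ∑ m ∈ Finset.range d, x ^ m * y ^ (d - m) = ∑ m ∈ Finset.range d, y ^ m * x ^ (d - m) := by
  cases d with
  | zero => simp
  | succ d =>
    rw [Finset.sum_range_succ', Finset.sum_range_succ']
    simp only [pow_zero, one_mul, Nat.sub_zero, hx, hy]
    congr 1
    rw [← Finset.sum_range_reflect]
    refine Finset.sum_congr rfl fun m hm => ?_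
    have hm := Finset.mem_range.1 hm
    rw [show d - 1 - m + 1 = d + 1 - (m + 1) by omega,
      show d + 1 - (d + 1 - (m + 1)) = m + 1 by omega]
    exact (Commute.pow_pow hxy _ _).eq

theorem commute_conj_of_braid {g h g' h' b : R} (hgg : g * g' = 1) (hgg' : g' * g = 1)
    (hhh : h * h' = 1) (hhh' : h' * h = 1) (br : g * h * g = h * g * h) (hb : Commute h b)
    (hbb : b * g * b * g = g * b * g * b) :
    (g * b * g') * h * (g * b * g') * h = h * (g * b * g') * h * (g * b * g') := by
  have hc : g' * h * g = h * g * h' := by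
    calc g' * h * g = g' * (h * g * h) * h' := by simp only [mul_assoc, hhh, mul_one]
      _ = h * g * h' := by rw [← br]; simp only [← mul_assoc, hgg', one_mul]
  have hhg : h * g = g * (h * g * h') := by
    rw [← hc]; simp only [← mul_assoc, hgg, one_mul]
  have hgh : g' * h = (h * g * h') * g' := by
    rw [← hc]; simp only [mul_assoc, hgg, mul_one]
  have hb' : h' * b = b * h' := by
    calc h' * b = h' * (b * h) * h' := by simp only [mul_assoc, hhh, mul_one]
      _ = b * h' := by rw [← hb.eq]; simp only [← mul_assoc, hhh', one_mul]
  have hbh : b * h = h * b := hb.eq.symm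
  have key : b * (h * g * h') * b * (h * g * h') = (h * g * h') * b * (h * g * h') * b := by
    calc b * (h * g * h') * b * (h * g * h')
        = (b * h) * g * (h' * b) * h * g * h' := by simp only [mul_assoc]
      _ = h * (b * g * b * g) * h' := by
          rw [hb', hbh]; simp only [mul_assoc, hhh', one_mul]
      _ = h * g * b * g * (h' * b) := by rw [hbb, hb']; simp only [mul_assoc]
      _ = h * g * b * (h' * h) * g * h' * b := by rw [hhh']; simp only [mul_assoc, one_mul]
      _ = h * g * (b * h') * h * g * h' * b := by simp only [mul_assoc]
      _ = (h * g * h') * b * (h * g * h') * b := by rw [← hb']; simp only [mul_assoc]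
  calc (g * b * g') * h * (g * b * g') * h
      = g * b * (g' * h * g) * b * (g' * h) := by simp only [mul_assoc]
    _ = g * (b * (h * g * h') * b * (h * g * h')) * g' := by
        rw [hc, hgh]; simp only [mul_assoc]
    _ = g * (h * g * h') * b * (g' * h * g) * b * g' := by
        rw [key, hc]; simp only [mul_assoc]
    _ = h * (g * b * g') * h * (g * b * g') := by rw [← hhg]; simp only [mul_assoc]

theorem braid_intertwine_step {g h g' h' b c p : R} (hgg' : g' * g = 1)
    (hhh : h * h' = 1) (hhh' : h' * h = 1) (br : g * h * g = h * g * h) (hb : Commute h b)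
    (hp : Commute h p) (ih : g * p * c = b * (g * p)) :
    h * (g * p) * (h * c * h') = g * b * g' * (h * (g * p)) := by
  have hc : h * g * h' = g' * h * g := by
    symm
    calc g' * h * g = g' * (h * g * h) * h' := by simp only [mul_assoc, hhh, mul_one]
      _ = h * g * h' := by rw [← br]; simp only [← mul_assoc, hgg', one_mul]
  have hp' : p * h' = h' * p := by
    calc p * h' = h' * (h * p) * h' := by simp only [← mul_assoc, hhh', one_mul]
      _ = h' * p := by rw [hp.eq]; simp only [mul_assoc, hhh, mul_one]
  calc h * (g * p) * (h * c * h') = h * g * (p * h) * c * h' := by simp only [mul_assoc]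
    _ = (h * g * h) * p * c * h' := by rw [← hp.eq]; simp only [mul_assoc]
    _ = g * h * (g * p * c) * h' := by rw [← br]; simp only [mul_assoc]
    _ = g * (h * b) * g * (p * h') := by rw [ih]; simp only [mul_assoc]
    _ = g * b * (h * g * h') * p := by rw [hb.eq, hp']; simp only [mul_assoc]
    _ = g * b * g' * (h * (g * p)) := by rw [hc]; simp only [mul_assoc]

theorem commute_of_mul_eq {a g g' x : R} (hgg : g * g' = 1) (hgg' : g' * g = 1)
    {y : R} (h : a * g = g * x) (hx : Commute x y) : Commute a (g * y * g') := by
  have h' : x * g' = g' * a := by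
    calc x * g' = g' * (g * x) * g' := by simp only [← mul_assoc, hgg', one_mul]
      _ = g' * a := by rw [← h]; simp only [mul_assoc, hgg, mul_one]
  change a * (g * y * g') = g * y * g' * a
  calc a * (g * y * g') = a * g * y * g' := by simp only [mul_assoc]
    _ = g * (x * y) * g' := by rw [h]; simp only [mul_assoc]
    _ = g * y * (x * g') := by rw [hx.eq]; simp only [mul_assoc]
    _ = g * y * g' * a := by rw [h']; simp only [mul_assoc]

end Aux

theorem mkY_eq {d n : ℕ} {x y : FA n} (h : YBrel d n x y) : mkY d n x = mkY d n y :=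
  RingQuot.mkAlgHom_rel Kf h

theorem tY_mul_tY {d n i j : ℕ} (hi : 1 ≤ i) (hin : i ≤ n) (hj : 1 ≤ j) (hjn : j ≤ n) :
    tY d n i * tY d n j = tY d n j * tY d n i := by
  simpa only [map_mul] using! mkY_eq (d := d) (YBrel.tt i j hi hin hj hjn)

theorem tY_mul_gY {d n i j : ℕ} (hi : 1 ≤ i) (hin : i ≤ n - 1) (hj : 1 ≤ j) (hjn : j ≤ n) :
    tY d n j * gY d n i = gY d n i * tY d n (sAct i j) := by
  simpa only [map_mul] using! mkY_eq (d := d) (YBrel.tg i j hi hin hj hjn)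

theorem tY_pow {d n i : ℕ} (hi : 1 ≤ i) (hin : i ≤ n) : tY d n i ^ d = 1 := by
  simpa only [map_pow, map_one] using! mkY_eq (YBrel.td (d := d) i hi hin)

theorem eY_eq (d n i : ℕ) : eY d n i =
    (d : Kf)⁻¹ • ∑ m ∈ Finset.range d, tY d n i ^ m * tY d n (i + 1) ^ (d - m) := by
  simp only [eY, eF, map_smul, map_sum, map_mul, map_pow]
  rfl

theorem gY_sq {d n i : ℕ} (hi : 1 ≤ i) (hin : i ≤ n - 1) :
    gY d n i ^ 2 = 1 + (uu - uu⁻¹) • (eY d n i * gY d n i) := by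
  simpa only [map_mul, map_add, map_one, map_smul, map_pow] using!
    mkY_eq (YBrel.gsq (d := d) i hi hin)

theorem gY_braid {d n i : ℕ} (hi : 1 ≤ i) (hin : i ≤ n - 2) :
    gY d n i * gY d n (i + 1) * gY d n i = gY d n (i + 1) * gY d n i * gY d n (i + 1) := by
  simpa only [map_mul] using! mkY_eq (d := d) (YBrel.braid i hi hin)

theorem commute_gY {d n i j : ℕ} (hi : 1 ≤ i) (hin : i ≤ n - 1) (hj : 1 ≤ j) (hjn : j ≤ n - 1)
    (h : i + 1 < j ∨ j + 1 < i) : Commute (gY d n i) (gY d n j) := by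
  simpa only [map_mul] using! mkY_eq (d := d) (YBrel.gg i j hi hin hj hjn h)

theorem commute_gY_bY {d n i : ℕ} (hi : 2 ≤ i) (hin : i ≤ n - 1) :
    Commute (gY d n i) (bY d n) := by
  have h : bY d n * gY d n i = gY d n i * bY d n := by
    simpa only [map_mul] using! mkY_eq (d := d) (YBrel.bg i hi hin)
  exact h.symm

theorem bY_gY_bY_gY (d n : ℕ) :
    bY d n * gY d n 1 * bY d n * gY d n 1 = gY d n 1 * bY d n * gY d n 1 * bY d n := by
  simpa only [map_mul] using! mkY_eq (YBrel.bgbg (d := d) (n := n))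

theorem commute_tY_bY {d n i : ℕ} (hi : 1 ≤ i) (hin : i ≤ n) :
    Commute (tY d n i) (bY d n) := by
  simpa only [map_mul] using! mkY_eq (d := d) (YBrel.tb i hi hin)

theorem commute_eY_gY {d n i : ℕ} (hi : 1 ≤ i) (hin : i ≤ n - 1) :
    Commute (eY d n i) (gY d n i) := by
  have h1 : SemiconjBy (gY d n i) (tY d n (i + 1)) (tY d n i) := by
    have := tY_mul_gY (d := d) hi hin hi (by omega)
    rw [sAct, if_pos rfl] at this
    exact this.symm
  have h2 : SemiconjBy (gY d n i) (tY d n i) (tY d n (i + 1)) := by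
    have := tY_mul_gY (d := d) (j := i + 1) hi hin (by omega) (by omega)
    rw [sAct, if_neg (by omega), if_pos rfl] at this
    exact this.symm
  have hs : (∑ m ∈ Finset.range d, tY d n i ^ m * tY d n (i + 1) ^ (d - m)) * gY d n i =
      gY d n i * ∑ m ∈ Finset.range d, tY d n i ^ m * tY d n (i + 1) ^ (d - m) := by
    conv_rhs => rw [sum_range_pow_mul_pow_comm
      (tY_mul_tY hi (by omega) (by omega) (by omega)) (tY_pow hi (by omega))
      (tY_pow (by omega) (by omega))]
    rw [Finset.sum_mul, Finset.mul_sum]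
    exact Finset.sum_congr rfl fun m _ => ((h1.pow_right m).mul_right (h2.pow_right _)).eq.symm
  rw [eY_eq]
  exact Commute.smul_left hs _

theorem gY_mul_gInv {d n i : ℕ} (hi : 1 ≤ i) (hin : i ≤ n - 1) : gY d n i * gInv d n i = 1 := by
  rw [gInv, mul_sub, ← sq, gY_sq hi hin, mul_smul_comm, (commute_eY_gY hi hin).eq,
    add_sub_cancel_right]

theorem gInv_mul_gY {d n i : ℕ} (hi : 1 ≤ i) (hin : i ≤ n - 1) : gInv d n i * gY d n i = 1 := by
  rw [gInv, sub_mul, ← sq, gY_sq hi hin, smul_mul_assoc, add_sub_cancel_right]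

theorem bk_succ {d n k : ℕ} (hk : 1 ≤ k) :
    bk d n (k + 1) = gY d n k * bk d n k * gInv d n k := by
  obtain ⟨k, rfl⟩ := Nat.exists_eq_add_of_le' hk
  rfl

theorem commute_tY_bk {d n i k : ℕ} (hk : 1 ≤ k) (hkn : k ≤ n) (hi : 1 ≤ i) (hin : i ≤ n) :
    Commute (tY d n i) (bk d n k) := by
  induction k, hk using Nat.le_induction generalizing i with
  | base => exact commute_tY_bY hi hin
  | succ k hk ih =>
    rw [bk_succ hk]
    refine commute_of_mul_eq (gY_mul_gInv hk (by omega)) (gInv_mul_gY hk (by omega))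
      (tY_mul_gY hk (by omega) hi hin) (ih (by omega) ?_ ?_) <;>
    · unfold sAct
      split_ifs <;> omega

theorem commute_gY_bk {d n i k : ℕ} (hk : 1 ≤ k) (hki : k < i) (hin : i ≤ n - 1) :
    Commute (gY d n i) (bk d n k) := by
  induction k, hk using Nat.le_induction with
  | base => exact commute_gY_bY (by omega) hin
  | succ k hk ih =>
    rw [bk_succ hk]
    exact commute_of_mul_eq (gY_mul_gInv hk (by omega)) (gInv_mul_gY hk (by omega))
      (commute_gY (by omega) hin hk (by omega) (by omega)).eq (ih (by omega))

theorem bk_gY_bk_gY {d n k : ℕ} (hk : 1 ≤ k) (hkn : k ≤ n - 1) :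
    bk d n k * gY d n k * bk d n k * gY d n k = gY d n k * bk d n k * gY d n k * bk d n k := by
  induction k, hk using Nat.le_induction with
  | base => exact bY_gY_bY_gY d n
  | succ k hk ih =>
    rw [bk_succ hk]
    exact commute_conj_of_braid (gY_mul_gInv hk (by omega)) (gInv_mul_gY hk (by omega))
      (gY_mul_gInv (by omega) hkn) (gInv_mul_gY (by omega) hkn) (gY_braid hk (by omega))
      (commute_gY_bk hk (by omega) hkn) (ih (by omega))

theorem gRange_self (d n j : ℕ) : gRange d n j j = 1 := by
  simp [gRange]

theorem gRange_succ {d n j k : ℕ} (h : j ≤ k) :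
    gRange d n j (k + 1) = gY d n k * gRange d n j k := by
  rw [gRange, Nat.sub_add_comm h, List.range'_concat, List.reverse_append]
  simp [gRange, Nat.add_sub_cancel' h]

theorem commute_gY_gRange_mul {d n i j k m : ℕ} (hj : 1 ≤ j) (hjk : j ≤ k) (hki : k < i)
    (hin : i ≤ n - 1) :
    Commute (gY d n i) (gRange d n j k * (bk d n j * tY d n j ^ m)) := by
  induction k, hjk using Nat.le_induction with
  | base =>
    rw [gRange_self, one_mul]
    refine (commute_gY_bk hj hki hin).mul_right (Commute.pow_right ?_ m)
    have h := tY_mul_gY (d := d) (by omega) hin hj (by omega : j ≤ n)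
    rw [sAct, if_neg (by omega), if_neg (by omega)] at h
    exact h.symm
  | succ k hjk ih =>
    rw [gRange_succ hjk, mul_assoc]
    exact (commute_gY (by omega) hin (by omega) (by omega) (by omega)).mul_right (ih (by omega))

theorem gRange_mul_bk {d n j k m : ℕ} (hj : 1 ≤ j) (hjk : j ≤ k) (hkn : k ≤ n - 1) :
    gRange d n j (k + 1) * (bk d n j * tY d n j ^ m) * bk d n (k + 1) =
      bk d n k * (gRange d n j (k + 1) * (bk d n j * tY d n j ^ m)) := by
  induction k, hjk using Nat.le_induction with
  | base =>
    have ht := ((commute_tY_bk (d := d) (k := j + 1) (by omega) (by omega) hj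
      (by omega : j ≤ n)).pow_left m).eq
    rw [gRange_succ le_rfl, gRange_self, mul_one, mul_assoc, mul_assoc (bk d n j), ht,
      bk_succ hj]
    have hg := gY_mul_gInv (d := d) hj hkn
    calc gY d n j * (bk d n j * (gY d n j * bk d n j * gInv d n j * tY d n j ^ m))
        = gY d n j * bk d n j * gY d n j * bk d n j * gInv d n j * tY d n j ^ m := by
          simp only [mul_assoc]
      _ = bk d n j * (gY d n j * (bk d n j * tY d n j ^ m)) := by
          rw [← bk_gY_bk_gY hj hkn, mul_assoc _ (gY d n j) (gInv d n j), hg]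
          simp only [mul_assoc, mul_one]
  | succ k hjk ih =>
    have hk : 1 ≤ k := hj.trans hjk
    have ih := ih (by omega)
    rw [gRange_succ hjk, mul_assoc (gY d n k)] at ih
    rw [gRange_succ (by omega), gRange_succ hjk, mul_assoc (gY d n (k + 1)),
      mul_assoc (gY d n k), bk_succ (by omega : 1 ≤ k + 1)]
    conv_rhs => rw [bk_succ hk]
    exact braid_intertwine_step (gInv_mul_gY hk (by omega))
      (gY_mul_gInv (by omega) hkn) (gInv_mul_gY (by omega) hkn) (gY_braid hk (by omega))
      (commute_gY_bk hk (by omega) hkn) (commute_gY_gRange_mul hj hjk (by omega) hkn) ih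

/-- (i) `𝔪⁻_{k,j,m} b_k = b_{k-1} 𝔪⁻_{k,j,m}`;
(ii) `g_{n-1} X g_{n-1}⁻¹ = g_{n-1}⁻¹ X g_{n-1} + (u-u⁻¹)(e_{n-1} X g_{n-1} - g_{n-1} X e_{n-1})`;
(iii) `g_{k-1}² b_{k-1} g_{k-1}⁻¹ = b_{k-1} g_{k-1} - (u-u⁻¹) b_{k-1} e_{k-1} + (u-u⁻¹) e_{k-1} b_k`. -/
theorem stmt11 (d n : ℕ) (hd : 1 ≤ d) (hn : 2 ≤ n) :
    (∀ k j m, 2 ≤ k → k ≤ n → 1 ≤ j → j ≤ k - 1 → m ≤ d - 1 →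
      mMinus d n k j m * bk d n k = bk d n (k - 1) * mMinus d n k j m) ∧
    (∀ X : YB d n,
      gY d n (n - 1) * X * gInv d n (n - 1) =
        gInv d n (n - 1) * X * gY d n (n - 1) +
          (uu - uu⁻¹) • (eY d n (n - 1) * X * gY d n (n - 1) -
            gY d n (n - 1) * X * eY d n (n - 1))) ∧
    (∀ k, 2 ≤ k → k ≤ n →
      gY d n (k - 1) ^ 2 * bk d n (k - 1) * gInv d n (k - 1) =
        bk d n (k - 1) * gY d n (k - 1) - (uu - uu⁻¹) • (bk d n (k - 1) * eY d n (k - 1)) +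
          (uu - uu⁻¹) • (eY d n (k - 1) * bk d n k)) := by
  refine ⟨fun k j m hk hkn hj hjk _ => ?_, fun X => ?_, fun k hk hkn => ?_⟩
  · obtain ⟨k, rfl⟩ := Nat.exists_eq_add_of_le' (by omega : 1 ≤ k)
    rw [mMinus, if_neg (by omega)]
    exact gRange_mul_bk hj hjk (by omega)
  · simp only [gInv, mul_sub, sub_mul, mul_smul_comm, smul_mul_assoc, smul_sub]
    abel
  · obtain ⟨k, rfl⟩ := Nat.exists_eq_add_of_le' (by omega : 1 ≤ k)
    rw [Nat.add_sub_cancel, gY_sq (by omega) (by omega), bk_succ (by omega), add_mul, add_mul,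
      one_mul, smul_mul_assoc, smul_mul_assoc]
    congr 1
    · rw [gInv, mul_sub, mul_smul_comm]
    · simp only [mul_assoc]
end
end
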